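/- The connectivity of the matching complex of the (1 × 1 × t)-honeycomb graph (the polygonal line tiling P_{3,t} of t hexagons) is exactly t − 1; that is, M(P_{3,t}) is (t−1)-connected but not t-connected. -/

import Mathlib

/-! ## Simplicial complexes, realizations, and homotopy-theoretic notions -/

/-- The independence complex of a simple graph, as an abstract simplicial complex:
the collection of finite independent sets of vertices. -/
def indepCx {V : Type} (G : SimpleGraph V) : Set (Finset V) :=
  {s | ∀ u ∈ s, ∀ v ∈ s, ¬ G.Adj u v}

/-- The matching complex of a simple graph: the collection of finite sets of edges,
no two of which share an endpoint. -/
def matchCx {V : Type} (G : SimpleGraph V) : Set (Finset (Sym2 V)) :=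
  {s | (↑s : Set (Sym2 V)) ⊆ G.edgeSet ∧
    ∀ e ∈ s, ∀ e' ∈ s, e ≠ e' → ∀ x : V, x ∈ e → x ∉ e'}

/-- The geometric realization of an abstract simplicial complex `K` on vertex set `V`:
the space of convex-combination weight functions supported on a simplex of `K`. -/
def geom {V : Type} (K : Set (Finset V)) : Type :=
  {f : V → ℝ // (∃ s ∈ K, ∀ v, f v ≠ 0 → v ∈ s) ∧ (∀ v, 0 ≤ f v) ∧ ∑ᶠ v, f v = 1}

noncomputable instance geom.topInst {V : Type} (K : Set (Finset V)) :
    TopologicalSpace (geom K) :=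
  instTopologicalSpaceSubtype

/-- A continuous map is a homotopy equivalence. -/
def IsHtpyEquiv {X Y : Type} [TopologicalSpace X] [TopologicalSpace Y] (f : C(X, Y)) : Prop :=
  ∃ g : C(Y, X), (g.comp f).Homotopic (ContinuousMap.id X) ∧
    (f.comp g).Homotopic (ContinuousMap.id Y)

/-- Any singleton vertex set is independent. -/
lemma singleton_mem_indepCx {V : Type} (G : SimpleGraph V) (v : V) :
    ({v} : Finset V) ∈ indepCx G := by
  intro u hu w hw
  simp only [Finset.mem_singleton] at hu hw
  subst hu; subst hw
  exact G.irrefl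

/-- The point of a geometric realization corresponding to a vertex. -/
noncomputable def geomPt {V : Type} [DecidableEq V] {K : Set (Finset V)} (v : V)
    (h : ({v} : Finset V) ∈ K) : geom K := by
  refine ⟨fun w => if w = v then 1 else 0, ⟨{v}, h, fun w hw => ?_⟩, fun w => ?_, ?_⟩
  · by_cases hwv : w = v
    · simp [hwv]
    · simp [hwv] at hw
  · by_cases hwv : w = v <;> simp [hwv]
  · rw [finsum_eq_single _ v (fun x hx => if_neg hx)]
    simp

/-- The `k`-dimensional sphere. -/
def Sph (k : ℕ) : Type := Metric.sphere (0 : EuclideanSpace ℝ (Fin (k+1))) 1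

noncomputable instance Sph.topInst (k : ℕ) : TopologicalSpace (Sph k) := by
  unfold Sph; infer_instance

/-- A pointed topological space. -/
structure Ptd where
  carrier : Type
  [topInst : TopologicalSpace carrier]
  pt : carrier

attribute [instance] Ptd.topInst

/-- The one-point pointed space. -/
def Ptd.point : Ptd := { carrier := PUnit, pt := PUnit.unit }

/-- The `k`-sphere as a pointed space. -/
noncomputable def Ptd.sphere (k : ℕ) : Ptd where
  carrier := Sph k
  pt := ⟨EuclideanSpace.single 0 1, by
    simp [mem_sphere_iff_norm, EuclideanSpace.norm_single]⟩

/-- The wedge sum of two pointed spaces. -/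
def Ptd.wedge (X Y : Ptd) : Ptd where
  carrier := Quot (fun p q : X.carrier ⊕ Y.carrier => p = q ∨
    (p = Sum.inl X.pt ∧ q = Sum.inr Y.pt) ∨ (p = Sum.inr Y.pt ∧ q = Sum.inl X.pt))
  pt := Quot.mk _ (Sum.inl X.pt)

/-- The reduced suspension of a pointed space: in `X × [0,1]`, collapse
`X × {0} ∪ X × {1} ∪ {pt} × [0,1]` to a point. -/
def Ptd.susp (X : Ptd) : Ptd where
  carrier := Quot (fun p q : X.carrier × unitInterval => p = q ∨
    ((p.2 = 0 ∨ p.2 = 1 ∨ p.1 = X.pt) ∧ (q.2 = 0 ∨ q.2 = 1 ∨ q.1 = X.pt)))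
  pt := Quot.mk _ (X.pt, 0)

/-- Iterated reduced suspension `Σ^k`. -/
def Ptd.suspIter (k : ℕ) (X : Ptd) : Ptd := Ptd.susp^[k] X

/-- The wedge of `k` copies of a pointed space (the empty wedge being a point). -/
def Ptd.wedgeIter : ℕ → Ptd → Ptd
  | 0, _ => Ptd.point
  | k+1, X => (Ptd.wedgeIter k X).wedge X

/-- A finite wedge of spheres of prescribed dimensions (the empty wedge being a point). -/
noncomputable def wedgeOfSpheres : List ℕ → Ptd
  | [] => Ptd.point
  | d :: ds => (Ptd.sphere d).wedge (wedgeOfSpheres ds)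

/-- A space is `k`-connected (`k : ℤ`): it is nonempty whenever `k ≥ -1`, and every
continuous map from a sphere of dimension `≤ k` into it is null-homotopic. -/
def IsConn (X : Type) [TopologicalSpace X] (k : ℤ) : Prop :=
  (-1 ≤ k → Nonempty X) ∧
    ∀ i : ℕ, (i : ℤ) ≤ k → ∀ f : C(Sph i, X), ∃ x : X,
      f.Homotopic (ContinuousMap.const _ x)

/-! ## Inclusions of independence complexes of induced subgraphs -/

/-- Extension by zero of a function defined on a subset of `V`. -/
noncomputable def extendZero {V : Type} {S : Set V} (f : ↥S → ℝ) : V → ℝ :=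
  Function.extend Subtype.val f 0

lemma extendZero_mem {V : Type} {S : Set V} (f : ↥S → ℝ) (x : ↥S) :
    extendZero f ↑x = f x :=
  Subtype.val_injective.extend_apply f 0 x

lemma extendZero_not_mem {V : Type} {S : Set V} (f : ↥S → ℝ) {v : V} (h : v ∉ S) :
    extendZero f v = 0 :=
  Function.extend_apply' f (0 : V → ℝ) v (fun ⟨x, hx⟩ => h (hx ▸ x.2))

lemma finsum_extendZero {V : Type} {S : Set V} (f : ↥S → ℝ) :
    ∑ᶠ v, extendZero f v = ∑ᶠ x : ↥S, f x := by
  rw [show (fun x : ↥S => f x) = fun x : ↥S => extendZero f ↑x from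
      funext fun x => (extendZero_mem f x).symm,
    finsum_set_coe_eq_finsum_mem, ← finsum_mem_univ (f := extendZero f),
    finsum_mem_inter_support_eq' _ Set.univ S]
  intro x hx
  simp only [Set.mem_univ, true_iff]
  exact by_contra fun h => hx (extendZero_not_mem f h)

/-- An independent set of an induced subgraph is independent in the ambient graph. -/
lemma indep_image {V : Type} [DecidableEq V] (G : SimpleGraph V) (S : Set V)
    {s : Finset ↥S} (hs : s ∈ indepCx (G.induce S)) :
    s.image Subtype.val ∈ indepCx G := by
  intro u hu v hv
  simp only [Finset.mem_image] at hu hv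
  obtain ⟨u', hu', rfl⟩ := hu
  obtain ⟨v', hv', rfl⟩ := hv
  exact hs u' hu' v' hv'

/-- The inclusion of the realization of the independence complex of an induced
subgraph into that of the ambient graph (extension of weight functions by zero). -/
noncomputable def inclMap {V : Type} [DecidableEq V] (G : SimpleGraph V) (S : Set V) :
    C(geom (indepCx (G.induce S)), geom (indepCx G)) where
  toFun f := ⟨extendZero f.1, by
      obtain ⟨s, hsK, hsupp⟩ := f.2.1
      refine ⟨s.image Subtype.val, indep_image G S hsK, fun v hv => ?_⟩
      by_cases h : v ∈ S
      · rw [show v = ↑(⟨v, h⟩ : ↥S) from rfl, extendZero_mem] at hv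
        exact Finset.mem_image.2 ⟨⟨v, h⟩, hsupp _ hv, rfl⟩
      · exact absurd (extendZero_not_mem f.1 h) hv,
    fun v => by
      by_cases h : v ∈ S
      · rw [show v = ↑(⟨v, h⟩ : ↥S) from rfl, extendZero_mem]; exact f.2.2.1 _
      · rw [extendZero_not_mem f.1 h],
    by rw [finsum_extendZero]; exact f.2.2.2⟩
  continuous_toFun := by
    apply Continuous.subtype_mk
    apply continuous_pi
    intro v
    by_cases h : v ∈ S
    · have : (fun f : geom (indepCx (G.induce S)) => extendZero f.1 v) =
        fun f : geom (indepCx (G.induce S)) => f.1 ⟨v, h⟩ :=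
        funext fun f => extendZero_mem f.1 ⟨v, h⟩
      rw [this]
      exact (continuous_apply _).comp continuous_subtype_val
    · have : (fun f : geom (indepCx (G.induce S)) => extendZero f.1 v) =
        fun _ => (0 : ℝ) := funext fun f => extendZero_not_mem f.1 h
      rw [this]
      exact continuous_const

/-! ## The graphs `G_{n,t}` and `H_{n,t}` (line graphs of polygonal line tilings) -/

/-- Ambient vertex names for the graphs `G_{n,t}`: `a i`, `b i j`, `c i j`. -/
inductive GV : Type
  | a : ℕ → GV
  | b : ℕ → ℕ → GV
  | c : ℕ → ℕ → GV
deriving DecidableEq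

/-- The base adjacency rules of `G_{n,t}` on the ambient vertex names (the parameter
`t` is handled by restricting to the appropriate vertex set). -/
def gRel (n : ℕ) : GV → GV → Prop
  | .a i, .b i' j => i' = i + 1 ∧ (j = 1 ∨ j = n - 1)
  | .a i, .c i' j => i' = i ∧ (j = 1 ∨ j = n - 1)
  | .b i j, .b i' j' => (i' = i ∧ j' = j + 1) ∨ (i' = i + 1 ∧ j = n - 1 ∧ j' = 1)
  | .c i j, .c i' j' => (i' = i ∧ j' = j + 1) ∨ (i' = i + 1 ∧ j = n - 1 ∧ j' = 1)
  | _, _ => False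

/-- The graph on all ambient vertex names with the adjacency rules of the `G_{n,t}`. -/
def gFull (n : ℕ) : SimpleGraph GV := SimpleGraph.fromRel (gRel n)

/-- The vertex set of `G_{n,t}`:
`{a_0, …, a_t} ∪ {b_{i,j}, c_{i,j} : 1 ≤ i ≤ t, 1 ≤ j ≤ n-1}`. -/
def GVset (n t : ℕ) : Set GV :=
  {v | match v with
    | .a i => i ≤ t
    | .b i j => 1 ≤ i ∧ i ≤ t ∧ 1 ≤ j ∧ j ≤ n - 1
    | .c i j => 1 ≤ i ∧ i ≤ t ∧ 1 ≤ j ∧ j ≤ n - 1}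

/-- The graph `G_{n,t}`, the line graph of the polygonal line tiling of `t` `2n`-gons. -/
def lineG (n t : ℕ) : SimpleGraph (GVset n t) := (gFull n).induce (GVset n t)

/-- The vertex set of `H_{n,t}`: that of `G_{n,t}` plus `b_{t+1,1}` and `c_{t+1,1}`. -/
def HVset (n t : ℕ) : Set GV := GVset n t ∪ {GV.b (t+1) 1, GV.c (t+1) 1}

/-- The graph `H_{n,t}`, the induced subgraph of `G_{n,t+1}` on
`V(G_{n,t}) ∪ {b_{t+1,1}, c_{t+1,1}}`. -/
def lineH (n t : ℕ) : SimpleGraph (HVset n t) := (gFull n).induce (HVset n t)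

lemma a0_mem_GVset (n t : ℕ) : GV.a 0 ∈ GVset n t := by simp [GVset]

lemma a0_mem_HVset (n t : ℕ) : GV.a 0 ∈ HVset n t := Or.inl (a0_mem_GVset n t)

/-- The realization of `I(G_{n,t})`, pointed at the vertex `a_0`. -/
noncomputable def IG (n t : ℕ) : Ptd where
  carrier := geom (indepCx (lineG n t))
  pt := geomPt ⟨GV.a 0, a0_mem_GVset n t⟩ (singleton_mem_indepCx _ _)

/-- The realization of `I(H_{n,t})`, pointed at the vertex `a_0`. -/
noncomputable def IH (n t : ℕ) : Ptd where
  carrier := geom (indepCx (lineH n t))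
  pt := geomPt ⟨GV.a 0, a0_mem_HVset n t⟩ (singleton_mem_indepCx _ _)

/-- The vertex set of `X_t = G_{n,t} ∖ a_{t-1}`. -/
def XVset (n t : ℕ) : Set GV := GVset n t \ {GV.a (t-1)}

/-- The graph `X_t = G_{n,t} ∖ a_{t-1}`. -/
def lineX (n t : ℕ) : SimpleGraph (XVset n t) := (gFull n).induce (XVset n t)

/-- The vertex set of `Y_t = X_t ∖ a_{t-2}`. -/
def YVset (n t : ℕ) : Set GV := XVset n t \ {GV.a (t-2)}

/-- The graph `Y_t = X_t ∖ a_{t-2}`. -/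
def lineY (n t : ℕ) : SimpleGraph (YVset n t) := (gFull n).induce (YVset n t)

lemma a0_mem_XVset {n t : ℕ} (ht : 2 ≤ t) : GV.a 0 ∈ XVset n t := by
  refine ⟨a0_mem_GVset n t, fun h => ?_⟩
  rw [Set.mem_singleton_iff] at h
  injection h with h'
  omega

lemma a0_mem_YVset {n t : ℕ} (ht : 3 ≤ t) : GV.a 0 ∈ YVset n t := by
  refine ⟨a0_mem_XVset (by omega), fun h => ?_⟩
  rw [Set.mem_singleton_iff] at h
  injection h with h'
  omega

/-- The realization of `I(X_t)`, pointed at the vertex `a_0` (for `t ≥ 2`). -/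
noncomputable def IX (n t : ℕ) (ht : 2 ≤ t) : Ptd where
  carrier := geom (indepCx (lineX n t))
  pt := geomPt ⟨GV.a 0, a0_mem_XVset ht⟩ (singleton_mem_indepCx _ _)

/-- The realization of `I(Y_t)`, pointed at the vertex `a_0` (for `t ≥ 3`). -/
noncomputable def IY (n t : ℕ) (ht : 3 ≤ t) : Ptd where
  carrier := geom (indepCx (lineY n t))
  pt := geomPt ⟨GV.a 0, a0_mem_YVset ht⟩ (singleton_mem_indepCx _ _)

/-! ## The polygonal line tilings `P_{n,t}` themselves -/

/-- Ambient vertex names for the tiling `P_{n,t}`: `u i`/`v i` are the endpoints of the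
`i`-th shared (vertical) edge, and `p i j` / `q i j` are the intermediate vertices of
the top/bottom boundary path of the `i`-th polygon. -/
inductive PV : Type
  | u : ℕ → PV
  | v : ℕ → PV
  | p : ℕ → ℕ → PV
  | q : ℕ → ℕ → PV
deriving DecidableEq

/-- The base adjacency rules of the tiling `P_{n,t}` on the ambient vertex names. -/
def pRel (n : ℕ) : PV → PV → Prop
  | .u i, .v i' => i' = i
  | .u i, .u i' => i' = i + 1 ∧ n = 2
  | .v i, .v i' => i' = i + 1 ∧ n = 2
  | .u i, .p i' j => (i' = i + 1 ∧ j = 1) ∨ (i' = i ∧ j = n - 2)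
  | .v i, .q i' j => (i' = i + 1 ∧ j = 1) ∨ (i' = i ∧ j = n - 2)
  | .p i j, .p i' j' => i' = i ∧ j' = j + 1
  | .q i j, .q i' j' => i' = i ∧ j' = j + 1
  | _, _ => False

/-- The graph on all ambient tiling vertex names. -/
def pFull (n : ℕ) : SimpleGraph PV := SimpleGraph.fromRel (pRel n)

/-- The vertex set of `P_{n,t}`. -/
def PVset (n t : ℕ) : Set PV :=
  {w | match w with
    | .u i => i ≤ t
    | .v i => i ≤ t
    | .p i j => 1 ≤ i ∧ i ≤ t ∧ 1 ≤ j ∧ j ≤ n - 2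
    | .q i j => 1 ≤ i ∧ i ≤ t ∧ 1 ≤ j ∧ j ≤ n - 2}

/-- The polygonal line tiling `P_{n,t}` of `t` `2n`-gons. -/
def polyP (n t : ℕ) : SimpleGraph (PVset n t) := (pFull n).induce (PVset n t)

section

open Set Metric MeasureTheory Polynomial

/-- Evaluating `det (1 + s A)` at `s = 1` is a fixed affine combination of its values at any
`finrank + 1` distinct nodes. -/
theorem exists_weights_det_one_add {E : Type*} [NormedAddCommGroup E] [NormedSpace ℝ E]
    [FiniteDimensional ℝ E] (v : Fin (Module.finrank ℝ E + 1) → ℝ) (hv : Function.Injective v) :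
    ∃ w : Fin (Module.finrank ℝ E + 1) → ℝ, ∑ j, w j = 1 ∧
      ∀ A : E →L[ℝ] E, (1 + A).det = ∑ j, w j * (1 + v j • A).det := by
  classical
  refine ⟨fun j => (Lagrange.basis Finset.univ v j).eval 1, ?_, fun A => ?_⟩
  · rw [← Polynomial.eval_finsetSum, Lagrange.sum_basis hv.injOn Finset.univ_nonempty]
    simp
  · let b := Module.finBasis ℝ E
    let M := LinearMap.toMatrix b b (A : E →ₗ[ℝ] E)
    let p : ℝ[X] := ((X : ℝ[X]) • M.map C + (1 : Matrix _ _ ℝ).map C).det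
    have hp : ∀ s : ℝ, (1 + s • A).det = p.eval s := by
      intro s
      have h1 : (1 + s • A).det = LinearMap.det (1 + s • (A : E →ₗ[ℝ] E)) := rfl
      have hM : LinearMap.toMatrix b b (1 + s • (A : E →ₗ[ℝ] E)) = 1 + s • M := by
        rw [map_add, map_smul, LinearMap.toMatrix_one]
      rw [h1, ← LinearMap.det_toMatrix b, hM, ← Polynomial.coe_evalRingHom, RingHom.map_det]
      congr 1
      ext i j
      rcases eq_or_ne i j with rfl | h
      · simp only [Matrix.add_apply, Matrix.smul_apply, Matrix.one_apply_eq, smul_eq_mul,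
          RingHom.mapMatrix_apply, Matrix.map_apply, coe_evalRingHom, eval_add, eval_mul, eval_X,
          eval_C]
        ring
      · simp only [Matrix.add_apply, Matrix.smul_apply, Matrix.one_apply_ne h, smul_eq_mul,
          RingHom.mapMatrix_apply, Matrix.map_apply, coe_evalRingHom, eval_add, eval_mul, eval_X,
          eval_C]
        ring
    have hd : p.degree < (Finset.univ : Finset (Fin (Module.finrank ℝ E + 1))).card := by
      refine lt_of_le_of_lt Polynomial.degree_le_natDegree ?_
      have := Polynomial.natDegree_det_X_add_C_le M 1
      simp only [Fintype.card_fin] at this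
      simp only [Finset.card_univ, Fintype.card_fin, Nat.cast_lt]
      exact_mod_cast Nat.lt_succ_of_le this
    have h := Lagrange.eq_interpolate hv.injOn hd
    have h1 := hp 1
    rw [one_smul] at h1
    rw [h1]
    conv_lhs => rw [h]
    rw [Lagrange.interpolate_apply, Polynomial.eval_finsetSum]
    refine Finset.sum_congr rfl fun j _ => ?_
    rw [hp]
    simp [mul_comm]

theorem det_one_add_pos {E : Type*} [NormedAddCommGroup E] [NormedSpace ℝ E]
    [FiniteDimensional ℝ E] (A : E →L[ℝ] E) (hA : ‖A‖ < 1) : 0 < (1 + A).det := by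
  have hcont : Continuous fun s : ℝ => (1 + s • A).det :=
    ContinuousLinearMap.continuous_det.comp (by fun_prop)
  have hne : ∀ s ∈ Icc (0 : ℝ) 1, (1 + s • A).det ≠ 0 := by
    intro s hs h0
    have : LinearMap.det (1 + s • (A : E →ₗ[ℝ] E)) = 0 := h0
    obtain ⟨x, hx, hx0⟩ := (LinearMap.bot_lt_ker_of_det_eq_zero this).ne_bot |>
      (Submodule.ne_bot_iff _).1
    have h1 : x + s • A x = 0 := by simpa using hx
    have h2 : ‖x‖ = s * ‖A x‖ := by
      rw [← Real.norm_of_nonneg hs.1, ← norm_smul, ← norm_neg (s • A x),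
        ← eq_neg_of_add_eq_zero_left h1]
    have h3 := A.le_opNorm x
    have h4 : 0 < ‖x‖ := norm_pos_iff.2 hx0
    nlinarith [hs.1, hs.2, norm_nonneg (A x)]
  by_contra! hle
  have := intermediate_value_Icc' zero_le_one hcont.continuousOn
  obtain ⟨s, hs, h0⟩ := this (show (0 : ℝ) ∈ _ by
    simp only [one_smul, zero_smul, add_zero]
    refine ⟨hle, ?_⟩
    have : (1 : E →L[ℝ] E).det = 1 := by simp [ContinuousLinearMap.det]
    rw [this]; exact zero_le_one)
  exact hne s hs h0

/-- A function that is Lipschitz on a closed ball and vanishes on the bounding sphere stays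
Lipschitz when extended by zero. -/
theorem LipschitzOnWith.lipschitzWith_indicator_closedBall {E F : Type*} [NormedAddCommGroup E]
    [NormedSpace ℝ E] [NormedAddCommGroup F] {h : E → F} {L : NNReal} {r : ℝ}
    (hL : LipschitzOnWith L h (closedBall 0 r)) (h0 : ∀ x, ‖x‖ = r → h x = 0) :
    LipschitzWith L ((closedBall 0 r).indicator h) := by
  have key : ∀ x y : E, x ∈ closedBall 0 r → y ∉ closedBall 0 r →
      ‖h x‖ ≤ L * dist x y := by
    intro x y hx hy
    rw [mem_closedBall_zero_iff] at hx hy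
    have hc : ContinuousOn (fun τ : ℝ => ‖AffineMap.lineMap x y τ‖) (Icc 0 1) :=
      (AffineMap.lineMap_continuous.norm).continuousOn
    obtain ⟨τ, hτ, hz⟩ := intermediate_value_Icc zero_le_one hc
      (show r ∈ _ by simpa using ⟨hx, (not_le.1 hy).le⟩)
    have h1 := hL.dist_le_mul x (by simpa using hx) (AffineMap.lineMap x y τ) (by simp [← hz])
    rw [h0 _ hz, dist_zero_right, dist_left_lineMap, Real.norm_of_nonneg hτ.1] at h1
    refine h1.trans ?_
    have : τ * dist x y ≤ dist x y := mul_le_of_le_one_left dist_nonneg hτ.2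
    gcongr
  refine LipschitzWith.of_dist_le_mul fun x y => ?_
  by_cases hx : x ∈ closedBall 0 r <;> by_cases hy : y ∈ closedBall 0 r
  · simpa [hx, hy] using hL.dist_le_mul x hx y hy
  · simpa [indicator_of_mem hx, indicator_of_notMem hy] using key x y hx hy
  · simpa [indicator_of_mem hy, indicator_of_notMem hx, dist_comm] using key y x hy hx
  · simp only [indicator_of_notMem hx, indicator_of_notMem hy, dist_self]
    positivity

theorem surjective_id_add_of_lipschitz {E : Type*} [NormedAddCommGroup E] [CompleteSpace E]
    {k : E → E} {L : NNReal} (hk : LipschitzWith L k) (hL : L < 1) (y : E) :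
    ∃ x, x + k x = y := by
  have hc : ContractingWith L fun x => y - k x :=
    ⟨hL, LipschitzWith.of_dist_le_mul fun a b => by
      rw [dist_sub_left]; exact hk.dist_le_mul a b⟩
  refine ⟨hc.fixedPoint, ?_⟩
  have h1 : y - k hc.fixedPoint = hc.fixedPoint := hc.fixedPoint_isFixedPt
  nth_rewrite 1 [← h1]
  exact sub_add_cancel _ _

section

variable {E : Type*} [NormedAddCommGroup E] [InnerProductSpace ℝ E] [FiniteDimensional ℝ E]

/-- A small perturbation of the identity of a closed ball, fixing the boundary, is volume
preserving in the integrated sense. -/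
theorem integral_det_one_add_smul [MeasurableSpace E] [BorelSpace E] {h : E → E} {r : ℝ}
    (hh : ContDiff ℝ 1 h) (h0 : ∀ x, ‖x‖ = r → h x = 0)
    (hmaps : ∀ x, ‖x‖ ≤ r → ‖x + h x‖ ≤ r) {L : NNReal}
    (hL : ∀ x ∈ closedBall (0 : E) r, ‖fderiv ℝ h x‖ ≤ L) {s : ℝ} (hs0 : 0 ≤ s) (hs1 : s ≤ 1)
    (hsL : s * L < 1) :
    ∫ x in closedBall (0 : E) r, (1 + s • fderiv ℝ h x).det = volume.real (closedBall (0 : E) r) := by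
  have hd : Differentiable ℝ h := hh.differentiable one_ne_zero
  have hLip : LipschitzOnWith L h (closedBall 0 r) :=
    (convex_closedBall 0 r).lipschitzOnWith_of_nnnorm_fderiv_le (fun x _ => hd x)
      (fun x hx => hL x hx)
  have hLip' : LipschitzWith (s.toNNReal * L) fun x => s • (closedBall 0 r).indicator h x := by
    refine LipschitzWith.of_dist_le_mul fun x y => ?_
    rw [dist_smul₀, Real.norm_of_nonneg hs0]
    have := (hLip.lipschitzWith_indicator_closedBall h0).dist_le_mul x y
    simp only [NNReal.coe_mul, Real.coe_toNNReal s hs0, mul_assoc]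
    gcongr
  have hlt : s.toNNReal * L < 1 := by
    rw [← NNReal.coe_lt_coe]; simpa [Real.coe_toNNReal s hs0] using hsL
  have himage : (fun x => x + s • h x) '' closedBall 0 r = closedBall 0 r := by
    apply Subset.antisymm
    · rintro _ ⟨x, hx, rfl⟩
      have h1 : x + s • h x = (1 - s) • x + s • (x + h x) := by module
      simp only [h1]
      exact convex_closedBall 0 r hx (by simpa using hmaps x (by simpa using hx))
        (by linarith) hs0 (by ring)
    · intro y hy
      obtain ⟨x, hx⟩ := surjective_id_add_of_lipschitz hLip' hlt y
      by_cases hxr : x ∈ closedBall 0 r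
      · exact ⟨x, hxr, by simpa [indicator_of_mem hxr] using hx⟩
      · rw [indicator_of_notMem hxr] at hx
        simp at hx
        exact absurd (hx ▸ hy) hxr
  have hinj : InjOn (fun x => x + s • h x) (closedBall 0 r) := by
    intro x hx y hy hxy
    have h1 : x - y = s • h y - s • h x := by
      simp only at hxy
      rw [sub_eq_sub_iff_add_eq_add, hxy, add_comm]
    have h2 : ‖x - y‖ ≤ s * (L * ‖x - y‖) := by
      nth_rewrite 1 [h1]
      rw [← smul_sub, norm_smul, Real.norm_of_nonneg hs0]
      gcongr
      have := hLip.dist_le_mul y hy x hx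
      rwa [dist_eq_norm, dist_comm, dist_eq_norm] at this
    by_contra hne
    have : 0 < ‖x - y‖ := norm_pos_iff.2 (sub_ne_zero.2 hne)
    nlinarith
  have hderiv : ∀ x ∈ closedBall (0 : E) r, HasFDerivWithinAt (fun x => x + s • h x)
      (1 + s • fderiv ℝ h x) (closedBall 0 r) x := fun x _ =>
    ((hasFDerivAt_id x).add ((hd x).hasFDerivAt.const_smul s)).hasFDerivWithinAt
  have hpos : ∀ x ∈ closedBall (0 : E) r, 0 < (1 + s • fderiv ℝ h x).det := by
    intro x hx
    apply det_one_add_pos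
    rw [norm_smul, Real.norm_of_nonneg hs0]
    exact lt_of_le_of_lt (by gcongr; exact hL x hx) hsL
  have hvol := lintegral_abs_det_fderiv_eq_addHaar_image volume
    (measurableSet_closedBall (x := (0 : E)) (ε := r)) hderiv hinj
  rw [himage] at hvol
  rw [integral_eq_lintegral_of_nonneg_ae, Measure.real, ← hvol]
  · congr 1
    refine setLIntegral_congr_fun measurableSet_closedBall fun x hx => ?_
    simp only [abs_of_pos (hpos x hx)]
  · exact (ae_restrict_iff' measurableSet_closedBall).2 (ae_of_all _ fun x hx => (hpos x hx).le)
  · have : Continuous fun x => (1 + s • fderiv ℝ h x).det :=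
      ContinuousLinearMap.continuous_det.comp
        (continuous_const.add ((hh.continuous_fderiv one_ne_zero).const_smul s))
    exact this.aestronglyMeasurable

theorem not_contDiff_retraction {G : E → E} {r : ℝ} (hr : 0 < r) (hG : ContDiff ℝ 1 G)
    (hn : ∀ x, ‖G x‖ = r) : ¬ ∀ x, ‖x‖ = r → G x = x := by
  intro hb
  borelize E
  have hd : Differentiable ℝ G := hG.differentiable one_ne_zero
  set h : E → E := fun x => G x - x with hh
  have hhC : ContDiff ℝ 1 h := hG.sub contDiff_id
  have hfc := hhC.continuous_fderiv one_ne_zero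
  obtain ⟨L, hL⟩ := (isCompact_closedBall (0 : E) r).exists_bound_of_continuousOn
    hfc.continuousOn
  set L' : NNReal := L.toNNReal
  have hL' : ∀ x ∈ closedBall (0 : E) r, ‖fderiv ℝ h x‖ ≤ L' := fun x hx =>
    (hL x hx).trans (Real.le_coe_toNNReal L)
  have key : ∀ s : ℝ, 0 ≤ s → s ≤ 1 → s * L' < 1 →
      ∫ x in closedBall (0 : E) r, (1 + s • fderiv ℝ h x).det =
        volume.real (closedBall (0 : E) r) := fun s h0 h1 h2 =>
    integral_det_one_add_smul hhC (fun x hx => by simp [hh, hb x hx])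
      (fun x _ => by simp [hh, hn x]) hL' h0 h1 h2
  let v : Fin (Module.finrank ℝ E + 1) → ℝ := fun j => (1 / (L' + 1)) * (1 / ((j : ℕ) + 1))
  have hv : Function.Injective v := by
    intro i j hij
    have h1 : (1 / ((L' : ℝ) + 1)) ≠ 0 := by positivity
    have h2 := mul_left_cancel₀ h1 hij
    rw [one_div, one_div, inv_inj, add_left_inj, Nat.cast_inj] at h2
    exact Fin.ext h2
  obtain ⟨w, hw, hdet⟩ := exists_weights_det_one_add v hv
  have hzero : ∀ x, (1 + fderiv ℝ h x).det = 0 := by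
    intro x
    have h1 : 1 + fderiv ℝ h x = fderiv ℝ G x := by
      have : fderiv ℝ h x = fderiv ℝ G x - 1 :=
        ((hd x).hasFDerivAt.sub (hasFDerivAt_id x)).fderiv
      rw [this]; abel
    rw [h1]
    by_contra hne
    have hsurj : Function.Surjective (fderiv ℝ G x) := by
      intro y
      obtain ⟨z, hz⟩ := ((fderiv ℝ G x).toContinuousLinearEquivOfDetNeZero hne).surjective y
      exact ⟨z, by rwa [ContinuousLinearMap.toContinuousLinearEquivOfDetNeZero_apply] at hz⟩
    obtain ⟨y, hy⟩ := hsurj (G x)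
    have h2 : HasFDerivAt (fun x => inner ℝ (G x) (G x)) _ x :=
      (hd x).hasFDerivAt.inner ℝ (hd x).hasFDerivAt
    have h3 : (fun x => inner ℝ (G x) (G x)) = fun _ : E => r ^ 2 := by
      ext x; rw [real_inner_self_eq_norm_sq, hn]
    rw [h3] at h2
    have h4 := congrArg (fun T => T y) (h2.unique (hasFDerivAt_const (r ^ 2) x))
    simp [hy, hn] at h4
    nlinarith
  have hint : ∀ s : ℝ, IntegrableOn (fun x => (1 + s • fderiv ℝ h x).det)
      (closedBall (0 : E) r) := fun s =>
    (ContinuousLinearMap.continuous_det.comp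
      (continuous_const.add (hfc.const_smul s))).continuousOn.integrableOn_compact
      (isCompact_closedBall _ _)
  have hsum : ∫ x in closedBall (0 : E) r, (1 + fderiv ℝ h x).det =
      volume.real (closedBall (0 : E) r) := by
    rw [funext fun x => hdet (fderiv ℝ h x), integral_finsetSum _ fun j _ => (hint (v j)).const_mul (w j)]
    have : ∀ j, ∫ x in closedBall (0 : E) r, w j * (1 + v j • fderiv ℝ h x).det =
        w j * volume.real (closedBall (0 : E) r) := by
      intro j
      rw [integral_const_mul]
      have hj1 : 1 / (((j : ℕ) : ℝ) + 1) ≤ 1 := by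
        rw [div_le_one (by positivity)]; exact le_add_of_nonneg_left (by positivity)
      have hL1 : 1 / ((L' : ℝ) + 1) ≤ 1 := by
        rw [div_le_one (by positivity)]; exact le_add_of_nonneg_left (by positivity)
      have hj0 : 0 ≤ 1 / (((j : ℕ) : ℝ) + 1) := by positivity
      have hL0 : 0 ≤ 1 / ((L' : ℝ) + 1) := by positivity
      have hvL : v j ≤ 1 / ((L' : ℝ) + 1) := mul_le_of_le_one_right hL0 hj1
      rw [key (v j) (mul_nonneg hL0 hj0) (hvL.trans hL1)]
      calc v j * L' ≤ 1 / ((L' : ℝ) + 1) * L' := by gcongr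
        _ < 1 := by
          rw [one_div_mul_eq_div, div_lt_one (by positivity)]; exact lt_add_one _
    simp_rw [this, ← Finset.sum_mul, hw, one_mul]
  simp only [hzero, integral_zero] at hsum
  have : 0 < volume (closedBall (0 : E) r) := measure_closedBall_pos _ _ hr
  exact (ENNReal.toReal_pos this.ne' measure_closedBall_lt_top.ne).ne hsum

end

section
variable {E : Type*} [NormedAddCommGroup E] [InnerProductSpace ℝ E] [FiniteDimensional ℝ E]

/-- There is no continuous retraction of a ball onto its bounding sphere. -/
theorem not_continuous_retraction {f : E → E} (hf : Continuous f) (h1 : ∀ x, 1 ≤ ‖f x‖) :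
    ¬ ∀ x, 1 ≤ ‖x‖ → f x = x := by
  intro hx
  have hU : {x : E | 1 < ‖x‖} ∈ nhdsSet {x : E | 2 ≤ ‖x‖} :=
    (isOpen_lt continuous_const continuous_norm).mem_nhdsSet.2
      fun x (h : 2 ≤ ‖x‖) => show 1 < ‖x‖ by linarith
  have hfU : ContDiffOn ℝ (1 : ℕ∞) f {x : E | 1 < ‖x‖} :=
    contDiffOn_id.congr fun x (h : 1 < ‖x‖) => hx x h.le
  obtain ⟨g, hg, hgf, hgS, -⟩ := hf.exists_contDiff_approx_and_eqOn 1
    (ε := fun _ => (1 / 2 : ℝ)) continuous_const (fun _ => by norm_num)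
    (isClosed_le continuous_const continuous_norm) hU hfU
  have hg0 : ∀ x, g x ≠ 0 := by
    intro x h0
    have := hgf x
    rw [h0, dist_zero_left] at this
    linarith [h1 x]
  have hg' : ContDiff ℝ 1 g := hg
  have hG : ContDiff ℝ 1 fun x => (2 * ‖g x‖⁻¹) • g x :=
    (contDiff_const.mul ((hg'.norm ℝ hg0).inv fun x => norm_ne_zero_iff.2 (hg0 x))).smul hg'
  refine not_contDiff_retraction (r := 2) two_pos hG (fun x => ?_) fun x h2 => ?_
  · rw [norm_smul, norm_mul, norm_inv, norm_norm, Real.norm_two, mul_assoc,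
      inv_mul_cancel₀ (norm_ne_zero_iff.2 (hg0 x)), mul_one]
  · have : g x = x := (hgS (show 2 ≤ ‖x‖ from h2.ge)).trans (hx x (by linarith))
    simp [this, h2]

/-- The identity of the unit sphere of a finite-dimensional inner product space is not
homotopic to a constant map. -/
theorem not_nullhomotopic_id_sphere :
    ¬ (ContinuousMap.id (sphere (0 : E) 1)).Nullhomotopic := by
  classical
  rintro ⟨y, ⟨F⟩⟩
  have hν : ∀ x : E, x ≠ 0 → ‖x‖⁻¹ • x ∈ sphere (0 : E) 1 := fun x hx => by
    simp [norm_smul, inv_mul_cancel₀ (norm_ne_zero_iff.2 hx)]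
  let ν : E → sphere (0 : E) 1 := fun x => if hx : x = 0 then y else ⟨‖x‖⁻¹ • x, hν x hx⟩
  have hνc : ∀ x, x ≠ 0 → ContinuousAt ν x := by
    intro x hx
    rw [Topology.IsInducing.subtypeVal.continuousAt_iff]
    have h1 : ContinuousAt (fun x : E => ‖x‖⁻¹ • x) x :=
      (continuousAt_id.norm.inv₀ (norm_ne_zero_iff.2 hx)).smul continuousAt_id
    refine h1.congr ?_
    filter_upwards [isOpen_ne.mem_nhds hx] with z hz
    simp only [Function.comp, ν, dif_neg hz]
  let f : E → E := fun x => max 1 ‖x‖ • (F (projIcc 0 1 zero_le_one (2 - 2 * ‖x‖), ν x) : E)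
  refine not_continuous_retraction (f := f) (continuous_iff_continuousAt.2 fun x => ?_)
    (fun x => ?_) fun x hx => ?_
  · by_cases hx : x = 0
    · have : f =ᶠ[nhds x] fun _ => (y : E) := by
        have h2 : {z : E | ‖z‖ < 1 / 2} ∈ nhds x :=
          (isOpen_lt continuous_norm continuous_const).mem_nhds (by simp [hx])
        filter_upwards [h2] with z (hz : ‖z‖ < 1 / 2)
        simp only [f]
        rw [projIcc_of_right_le zero_le_one (show (1 : ℝ) ≤ 2 - 2 * ‖z‖ by linarith),
          max_eq_left (by linarith), one_smul]
        exact congrArg Subtype.val (F.apply_one _)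
      exact this.continuousAt
    · refine ContinuousAt.smul (by fun_prop) ?_
      refine continuous_subtype_val.continuousAt.comp (F.continuous.continuousAt.comp ?_)
      exact (continuous_projIcc.comp (by fun_prop)).continuousAt.prodMk (hνc x hx)
  · have := (F (projIcc 0 1 zero_le_one (2 - 2 * ‖x‖), ν x)).2
    rw [mem_sphere_zero_iff_norm] at this
    simp only [f]
    rw [norm_smul, this, mul_one, Real.norm_of_nonneg (by positivity)]
    exact le_max_left _ _
  · have hx0 : x ≠ 0 := by rintro rfl; norm_num at hx
    simp only [f]
    rw [projIcc_of_le_left zero_le_one (show 2 - 2 * ‖x‖ ≤ (0 : ℝ) by linarith),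
      max_eq_right hx]
    have : F (0, ν x) = ν x := F.apply_zero _
    erw [this]
    simp only [ν, dif_neg hx0]
    rw [smul_smul, mul_inv_cancel₀ (norm_ne_zero_iff.2 hx0), one_smul]

end

end

section

open Set Metric

/-- A complex that retracts, by a labelling of its vertices, onto the boundary of a
`(t + 1)`-dimensional cross-polytope is not `t`-connected. -/
theorem not_isConn_of_crossPolytope {V : Type} [Fintype V] {t : ℕ} {K : Set (Finset V)}
    (a g : Fin (t + 1) → V) (l : V → Fin (t + 1)) (ha : ∀ i, l (a i) = i) (hg : ∀ i, l (g i) = i)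
    (hag : ∀ i, g i ≠ a i)
    (hJ : ∀ s : Finset V, (∀ e ∈ s, e = a (l e) ∨ e = g (l e)) →
      (∀ i, a i ∈ s → g i ∉ s) → s ∈ K)
    (hK : ∀ s ∈ K, ∀ v ∈ s, a (l v) ∈ s → v = a (l v)) :
    ¬ IsConn (geom K) t := by
  classical
  rintro ⟨-, hconn⟩
  let N : EuclideanSpace ℝ (Fin (t + 1)) → ℝ := fun x => ∑ i, |x i|
  have hN : ∀ x : sphere (0 : EuclideanSpace ℝ (Fin (t + 1))) 1, 0 < N x := by
    intro x
    refine (Finset.sum_nonneg fun i _ => abs_nonneg _).lt_of_ne' fun h0 => ?_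
    have h1 : (x : EuclideanSpace ℝ (Fin (t + 1))) = 0 := by
      ext i
      simpa using (Finset.sum_eq_zero_iff_of_nonneg fun i _ => abs_nonneg _).1 h0 i
        (Finset.mem_univ i)
    have := x.2
    rw [h1] at this
    simp at this
  let φ : EuclideanSpace ℝ (Fin (t + 1)) → V → ℝ := fun x v =>
    (∑ i, ((if v = a i then max (-x i) 0 else 0) + (if v = g i then max (x i) 0 else 0))) / N x
  have hφc : Continuous fun x : sphere (0 : EuclideanSpace ℝ (Fin (t + 1))) 1 => φ x := by
    refine continuous_pi fun v => Continuous.div ?_ (by fun_prop) fun x => (hN x).ne'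
    refine continuous_finsetSum _ fun i _ => Continuous.add ?_ ?_ <;> split_ifs <;> fun_prop
  have hφ0 : ∀ x : sphere (0 : EuclideanSpace ℝ (Fin (t + 1))) 1, ∀ v, 0 ≤ φ x v := fun x v =>
    div_nonneg (Finset.sum_nonneg fun i _ => by
      apply add_nonneg <;> split_ifs <;> simp) (hN x).le
  have hφa : ∀ x : sphere (0 : EuclideanSpace ℝ (Fin (t + 1))) 1, ∀ v, φ x v ≠ 0 →
      (v = a (l v) ∧ (x : EuclideanSpace ℝ (Fin (t + 1))) (l v) < 0) ∨
        (v = g (l v) ∧ 0 < (x : EuclideanSpace ℝ (Fin (t + 1))) (l v)) := by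
    intro x v hv
    have h1 : ∑ i, ((if v = a i then max (-(x : EuclideanSpace ℝ (Fin (t + 1))) i) 0 else 0) +
        (if v = g i then max ((x : EuclideanSpace ℝ (Fin (t + 1))) i) 0 else 0)) ≠ 0 :=
      fun h => hv (by simp [φ, h])
    obtain ⟨i, -, hi⟩ := Finset.exists_ne_zero_of_sum_ne_zero h1
    by_cases h2 : v = a i
    · have h3 : v ≠ g i := fun h => hag i (h ▸ h2)
      rw [if_pos h2, if_neg h3, add_zero] at hi
      left
      rw [h2, ha]
      exact ⟨rfl, by by_contra! h; simp [h] at hi⟩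
    · rw [if_neg h2, zero_add] at hi
      have h3 : v = g i := by by_contra h; simp [h] at hi
      rw [if_pos h3] at hi
      right
      rw [h3, hg]
      exact ⟨rfl, by by_contra! h; simp [h] at hi⟩
  have hφs : ∀ x : sphere (0 : EuclideanSpace ℝ (Fin (t + 1))) 1, ∀ c : V → ℝ, ∑ v, c v * φ x v =
      (∑ i, (c (a i) * max (-(x : EuclideanSpace ℝ (Fin (t + 1))) i) 0 +
        c (g i) * max ((x : EuclideanSpace ℝ (Fin (t + 1))) i) 0)) / N x := by
    intro x c
    simp only [φ, mul_div_assoc']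
    rw [← Finset.sum_div]
    simp only [Finset.mul_sum, mul_add, mul_ite, mul_zero]
    rw [Finset.sum_comm]
    simp [Finset.sum_add_distrib]
  have hpm : ∀ y : ℝ, max (-y) 0 + max y 0 = |y| := fun y => by
    rcases le_total y 0 with h | h
    · rw [max_eq_left (by linarith), max_eq_right h, abs_of_nonpos h, add_zero]
    · rw [max_eq_right (by linarith), max_eq_left h, abs_of_nonneg h, zero_add]
  let Φ : C(sphere (0 : EuclideanSpace ℝ (Fin (t + 1))) 1, geom K) :=
    ⟨fun x => ⟨φ x, ⟨Finset.univ.filter fun v => φ x v ≠ 0, hJ _ (fun e he => by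
        have := hφa x e (Finset.mem_filter.1 he).2; tauto) (fun i h1 h2 => by
        have h3 := hφa x _ (Finset.mem_filter.1 h1).2
        have h4 := hφa x _ (Finset.mem_filter.1 h2).2
        rw [ha] at h3
        rw [hg] at h4
        have h5 := hag i
        rcases h3 with h3 | h3
        · rcases h4 with h4 | h4
          · exact h5 h4.1
          · linarith [h3.2, h4.2]
        · exact h5 h3.1.symm),
      fun v hv => by simpa using hv⟩, hφ0 x, by
        rw [finsum_eq_sum_of_fintype]
        have := hφs x fun _ => 1
        simp only [one_mul, hpm] at this
        rw [this]
        exact div_self (hN x).ne'⟩, hφc.subtype_mk _⟩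
  let c : Fin (t + 1) → V → ℝ := fun i v => if l v = i then (if v = a i then -1 else 1) else 0
  let ψ : geom K → EuclideanSpace ℝ (Fin (t + 1)) := fun f => WithLp.toLp 2 fun i => ∑ v, c i v * f.1 v
  have hψc : Continuous ψ := by
    refine (PiLp.continuous_toLp 2 _).comp (continuous_pi fun i =>
      continuous_finsetSum _ fun v _ => continuous_const.mul ?_)
    exact (continuous_apply v).comp continuous_subtype_val
  have hψ0 : ∀ f, ψ f ≠ 0 := by
    rintro ⟨f, ⟨s, hs, hsf⟩, hf0, hf1⟩ h0
    rw [finsum_eq_sum_of_fintype] at hf1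
    obtain ⟨v, -, hv⟩ := Finset.exists_ne_zero_of_sum_ne_zero (hf1.trans_ne one_ne_zero)
    have h1 : ∑ w, c (l v) w * f w = 0 := congrArg (fun y : EuclideanSpace ℝ (Fin (t + 1)) => y (l v)) h0
    by_cases hav : f (a (l v)) = 0
    · have hva : v ≠ a (l v) := fun h => hv (by rw [h, hav])
      refine (lt_of_lt_of_le ((hf0 v).lt_of_ne' hv) ?_).ne' h1
      have h2 : f v = c (l v) v * f v := by simp [c, hva]
      rw [h2]
      refine Finset.single_le_sum (f := fun w => c (l v) w * f w) (fun w _ => ?_)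
        (Finset.mem_univ v)
      by_cases hw : w = a (l v)
      · simp [hw, hav]
      · simp only [c, if_neg hw]
        split_ifs <;> simp [hf0 w]
    · rw [Finset.sum_eq_single (a (l v))] at h1
      · simp [c, ha] at h1
        exact hav h1
      · intro w _ hw
        by_cases hfw : f w = 0
        · simp [hfw]
        · by_cases hlw : l w = l v
          · refine absurd ?_ hw
            rw [← hlw]
            exact hK s hs w (hsf w hfw) (by rw [hlw]; exact hsf _ hav)
          · simp [c, hlw]
      · simp
  have hΨc : Continuous fun f => ‖ψ f‖⁻¹ • ψ f :=
    (hψc.norm.inv₀ fun f => norm_ne_zero_iff.2 (hψ0 f)).smul hψc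
  have hΨs : ∀ f, ‖ψ f‖⁻¹ • ψ f ∈ sphere (0 : EuclideanSpace ℝ (Fin (t + 1))) 1 := fun f => by
    simp [norm_smul, inv_mul_cancel₀ (norm_ne_zero_iff.2 (hψ0 f))]
  let Ψ : C(geom K, sphere (0 : EuclideanSpace ℝ (Fin (t + 1))) 1) :=
    ⟨fun f => ⟨‖ψ f‖⁻¹ • ψ f, hΨs f⟩, hΨc.subtype_mk hΨs⟩
  have hid : Ψ.comp Φ = ContinuousMap.id _ := by
    ext1 x
    have h1 : ψ (Φ x) = (N x)⁻¹ • (x : EuclideanSpace ℝ (Fin (t + 1))) := by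
      ext i
      have h2 := hφs x (c i)
      change ∑ v, c i v * φ x v = _
      rw [h2, PiLp.smul_apply, smul_eq_mul, div_eq_inv_mul]
      congr 1
      rw [Finset.sum_eq_single i]
      · simp only [c, ha, hg, if_true, if_neg (hag i)]
        rcases le_total ((x : EuclideanSpace ℝ (Fin (t + 1))) i) 0 with h | h
        · rw [max_eq_left (by linarith), max_eq_right h]; ring
        · rw [max_eq_right (by linarith), max_eq_left h]; ring
      · intro j _ hj
        simp [c, ha, hg, hj]
      · simp
    have hx : ‖(x : EuclideanSpace ℝ (Fin (t + 1)))‖ = 1 := mem_sphere_zero_iff_norm.1 x.2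
    refine Subtype.ext ?_
    change ‖ψ (Φ x)‖⁻¹ • ψ (Φ x) = (x : EuclideanSpace ℝ (Fin (t + 1)))
    rw [h1, norm_smul, hx, mul_one, Real.norm_of_nonneg (inv_nonneg.2 (hN x).le), inv_inv,
      smul_smul, mul_inv_cancel₀ (hN x).ne', one_smul]
  obtain ⟨y, hy⟩ := hconn t le_rfl Φ
  have h3 : (ContinuousMap.id (sphere (0 : EuclideanSpace ℝ (Fin (t + 1))) 1)).Nullhomotopic := by
    rw [← hid]
    exact ContinuousMap.Nullhomotopic.comp_right ⟨y, hy⟩ Ψ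
  exact not_nullhomotopic_id_sphere h3

/-- The support of a function on a finite type, as a finset. -/
noncomputable def finsupport {V : Type} [Fintype V] (f : V → ℝ) : Finset V :=
  open Classical in Finset.univ.filter fun v => f v ≠ 0

lemma mem_finsupport {V : Type} [Fintype V] {f : V → ℝ} {v : V} :
    v ∈ finsupport f ↔ f v ≠ 0 := by
  simp [finsupport]

lemma sum_finsupport {V : Type} [Fintype V] (f : V → ℝ) : ∑ v ∈ finsupport f, f v = ∑ v, f v :=
  Finset.sum_subset (Finset.subset_univ _) fun v _ hv => by simpa [mem_finsupport] using hv

/-- A continuous partition of unity is subordinate to a Lipschitz family with positive sum. -/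
theorem exists_lipschitzWith_subordinate {V X : Type} [Fintype V] [PseudoMetricSpace X]
    {f : X → V → ℝ} (hf : Continuous f) (hmem : ∀ x, f x ∈ stdSimplex ℝ V) :
    ∃ g : X → V → ℝ, LipschitzWith 1 g ∧ (∀ x v, 0 ≤ g x v) ∧
      (∀ x, finsupport (g x) ⊆ finsupport (f x)) ∧ ∀ x, 0 < ∑ v, g x v := by
  classical
  let δ : ℝ := 1 / (Fintype.card V + 1)
  have hδ : 0 < δ := by positivity
  let A : V → Set X := fun v => {x | f x v ≤ δ}
  have hA : ∀ v, IsClosed (A v) := fun v =>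
    isClosed_le ((continuous_apply v).comp hf) continuous_const
  let g : X → V → ℝ := fun x v => if A v = ∅ then 1 else infDist x (A v)
  have hg0 : ∀ x v, 0 ≤ g x v := fun x v => by
    simp only [g]; split_ifs
    exacts [zero_le_one, infDist_nonneg]
  refine ⟨g, LipschitzWith.of_dist_le_mul fun x y => ?_, hg0, fun x v hv => ?_, fun x => ?_⟩
  · rw [dist_pi_le_iff (by positivity)]
    intro v
    simp only [g]
    split_ifs
    · simp
    · exact (lipschitz_infDist_pt (A v)).dist_le_mul x y
  · rw [mem_finsupport] at hv ⊢
    simp only [g] at hv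
    split_ifs at hv with h
    · have : x ∉ A v := by simp [h]
      exact (hδ.trans (not_le.1 this)).ne'
    · have : x ∉ A v := fun h' => hv (infDist_zero_of_mem h')
      exact (hδ.trans (not_le.1 this)).ne'
  · obtain ⟨v, hv⟩ : ∃ v, δ < f x v := by
      by_contra! h
      have h1 : ∑ v, f x v ≤ ∑ _v : V, δ := Finset.sum_le_sum fun v _ => h v
      rw [(hmem x).2, Finset.sum_const, Finset.card_univ, nsmul_eq_mul] at h1
      have h2 : (Fintype.card V : ℝ) * δ < 1 := by
        rw [mul_one_div, div_lt_one (by positivity)]; exact lt_add_one _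
      linarith
    refine Finset.sum_pos' (fun v _ => hg0 x v) ⟨v, Finset.mem_univ v, ?_⟩
    simp only [g]
    split_ifs with h
    · exact one_pos
    · exact ((hA v).notMem_iff_infDist_pos (nonempty_iff_ne_empty.2 h)).1 (not_le.2 hv)

/-- A map of a `k`-dimensional space to a simplex can be pushed off the interior of a
`(k + 1)`-dimensional face. -/
theorem exists_not_subset_finsupport {V X : Type} [Fintype V] [MetricSpace X] {k : ℕ}
    (hX : dimH (univ : Set X) ≤ k) {f : X → V → ℝ} (hf : Continuous f)
    (hmem : ∀ x, f x ∈ stdSimplex ℝ V) {σ : Finset V} (hσ : σ.card = k + 2) :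
    ∃ f' : X → V → ℝ, Continuous f' ∧ (∀ x, f' x ∈ stdSimplex ℝ V) ∧
      (∀ x, finsupport (f' x) ⊆ finsupport (f x)) ∧ ∀ x, ¬ σ ⊆ finsupport (f' x) := by
  classical
  obtain ⟨g, hgL, hg0, hgs, hgp⟩ := exists_lipschitzWith_subordinate hf hmem
  have hσn : σ.Nonempty := Finset.card_pos.1 (by omega)
  obtain ⟨v₀, hv₀⟩ := hσn
  let P : (V → ℝ) → (σ.erase v₀ → ℝ) := fun y v => y v / ∑ w, y w
  have hconv : Convex ℝ {y : V → ℝ | 0 < ∑ w, y w} := by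
    have hlin : IsLinearMap ℝ fun y : V → ℝ => ∑ w, y w :=
      ⟨fun y z => by simp [Finset.sum_add_distrib], fun c y => by simp [Finset.mul_sum]⟩
    exact convex_halfSpace_gt hlin 0
  have hP : ContDiffOn ℝ 1 P {y : V → ℝ | 0 < ∑ w, y w} := by
    refine contDiffOn_pi.2 fun v => ContDiffOn.div (by fun_prop) (by fun_prop) ?_
    exact fun y hy => ne_of_gt hy
  have hdense : Dense (P '' range g)ᶜ := by
    refine hP.dense_compl_image_of_dimH_lt_finrank hconv (range_subset_iff.2 hgp) ?_
    refine (hgL.dimH_range_le.trans hX).trans_lt ?_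
    rw [Module.finrank_fintype_fun_eq_card, Fintype.card_coe, Finset.card_erase_of_mem hv₀, hσ]
    exact_mod_cast Nat.lt_succ_self k
  let U : Set (σ.erase v₀ → ℝ) := {y | (∀ v, 0 < y v) ∧ ∑ v, y v < 1}
  have hU : IsOpen U := by
    have h1 : U = (⋂ v, {y | 0 < y v}) ∩ {y | ∑ v, y v < 1} := by ext; simp [U]
    rw [h1]
    exact (isOpen_iInter_of_finite fun v => isOpen_lt continuous_const (continuous_apply v)).inter
      (isOpen_lt (by fun_prop) continuous_const)
  have hUn : U.Nonempty := by
    refine ⟨fun _ => 1 / (k + 2), fun _ => by positivity, ?_⟩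
    rw [Finset.sum_const, Finset.card_univ, Fintype.card_coe, Finset.card_erase_of_mem hv₀, hσ,
      nsmul_eq_mul, mul_one_div, div_lt_one (by positivity)]
    push_cast
    norm_num
  obtain ⟨y, hyU, hy⟩ := hdense.inter_open_nonempty U hU hUn
  let z : V → ℝ := fun v => if hv : v ∈ σ.erase v₀ then y ⟨v, hv⟩ else
    if v = v₀ then 1 - ∑ v, y v else 0
  have hz0 : ∀ v ∈ σ, 0 < z v := by
    intro v hv
    simp only [z]
    split_ifs with h1 h2
    · exact hyU.1 _
    · linarith [hyU.2]
    · exact absurd (Finset.mem_erase.2 ⟨h2, hv⟩) h1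
  have hzn : ∀ v, v ∉ σ → z v = 0 := by
    intro v hv
    simp only [z]
    rw [dif_neg fun h => hv (Finset.mem_of_mem_erase h), if_neg (ne_of_mem_of_not_mem hv₀ hv).symm]
  have hz1 : ∑ v ∈ σ, z v = 1 := by
    rw [← Finset.add_sum_erase _ _ hv₀, ← Finset.sum_coe_sort (σ.erase v₀)]
    have h1 : z v₀ = 1 - ∑ v, y v := by simp [z]
    have h2 : ∑ v : σ.erase v₀, z v = ∑ v, y v :=
      Finset.sum_congr rfl fun v _ => by simp only [z]; rw [dif_pos v.2]
    rw [h1, h2]; ring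
  have hz1' : ∑ v, z v = 1 := by
    rw [← hz1]
    exact (Finset.sum_subset (Finset.subset_univ _) fun v _ hv => hzn v hv).symm
  let h : X → V → ℝ := fun x v => g x v / ∑ w, g x w
  have hgc := hgL.continuous
  have hhc : Continuous h := continuous_pi fun v =>
    Continuous.div (by fun_prop) (by fun_prop) fun x => (hgp x).ne'
  have hh0 : ∀ x v, 0 ≤ h x v := fun x v => div_nonneg (hg0 x v) (hgp x).le
  have hh1 : ∀ x, ∑ v, h x v = 1 := fun x => by
    simp only [h]; rw [← Finset.sum_div, div_self (hgp x).ne']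
  have hhs : ∀ x v, h x v ≠ 0 → v ∈ finsupport (f x) := fun x v hv =>
    hgs x (mem_finsupport.2 fun h0 => hv (by simp [h, h0]))
  have hhz : ∀ x, h x ≠ z := by
    intro x hx
    refine hy ⟨g x, mem_range_self x, ?_⟩
    ext v
    change h x v = y v
    rw [hx]
    simp only [z]
    rw [dif_pos v.2]
  let μ : X → ℝ := fun x => σ.inf' ⟨v₀, hv₀⟩ fun v => h x v / z v
  have hμc : Continuous μ := Continuous.finset_inf'_apply _ fun v _ =>
    ((continuous_apply v).comp hhc).div_const _
  have hμle : ∀ x v, μ x * z v ≤ h x v := by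
    intro x v
    by_cases hv : v ∈ σ
    · rw [← le_div_iff₀ (hz0 v hv)]
      exact Finset.inf'_le _ hv
    · rw [hzn v hv, mul_zero]; exact hh0 x v
  have hμ0 : ∀ x, 0 ≤ μ x := fun x =>
    Finset.le_inf' _ _ fun v hv => div_nonneg (hh0 x v) (hz0 v hv).le
  have hμ1 : ∀ x, μ x < 1 := by
    intro x
    by_contra! hge
    have hle : ∀ v, z v ≤ h x v := fun v => by
      refine le_trans ?_ (hμle x v)
      by_cases hv : v ∈ σ
      · exact le_mul_of_one_le_left (hz0 v hv).le hge
      · rw [hzn v hv, mul_zero]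
    have := (Finset.sum_eq_sum_iff_of_le fun v (_ : v ∈ Finset.univ) => hle v).1
      (hz1'.trans (hh1 x).symm)
    exact hhz x (funext fun v => (this v (Finset.mem_univ v)).symm)
  refine ⟨fun x v => (h x v - μ x * z v) / (1 - μ x), ?_, fun x => ⟨fun v => ?_, ?_⟩,
    fun x v hv => ?_, fun x hsub => ?_⟩
  · exact continuous_pi fun v => Continuous.div (by fun_prop) (by fun_prop)
      fun x => (sub_pos.2 (hμ1 x)).ne'
  · exact div_nonneg (sub_nonneg.2 (hμle x v)) (sub_pos.2 (hμ1 x)).le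
  · rw [← Finset.sum_div, Finset.sum_sub_distrib, hh1, ← Finset.mul_sum, hz1', mul_one,
      div_self (sub_pos.2 (hμ1 x)).ne']
  · rw [mem_finsupport] at hv
    refine hhs x v fun h0 => hv ?_
    have h1 := hμle x v
    rw [h0] at h1
    have h2 : 0 ≤ μ x * z v := by
      by_cases hvσ : v ∈ σ
      · exact mul_nonneg (hμ0 x) (hz0 v hvσ).le
      · rw [hzn v hvσ, mul_zero]
    simp only [h0, le_antisymm h1 h2, sub_zero, zero_div]
  · obtain ⟨v, hv, hmin⟩ := Finset.exists_mem_eq_inf' ⟨v₀, hv₀⟩ fun v => h x v / z v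
    refine mem_finsupport.1 (hsub hv) ?_
    have : μ x = h x v / z v := hmin
    simp only
    rw [this, div_mul_cancel₀ _ (hz0 v hv).ne', sub_self, zero_div]

/-- A map of a `k`-dimensional space to a simplex can be pushed into the `k`-skeleton without
enlarging supports. -/
theorem exists_card_finsupport_le {V X : Type} [Fintype V] [MetricSpace X] {k : ℕ}
    (hX : dimH (univ : Set X) ≤ k) {f : X → V → ℝ} (hf : Continuous f)
    (hmem : ∀ x, f x ∈ stdSimplex ℝ V) :
    ∃ f' : X → V → ℝ, Continuous f' ∧ (∀ x, f' x ∈ stdSimplex ℝ V) ∧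
      (∀ x, finsupport (f' x) ⊆ finsupport (f x)) ∧ ∀ x, (finsupport (f' x)).card ≤ k + 1 := by
  classical
  have key : ∀ B : Finset (Finset V), (∀ σ ∈ B, σ.card = k + 2) →
      ∃ f' : X → V → ℝ, Continuous f' ∧ (∀ x, f' x ∈ stdSimplex ℝ V) ∧
      (∀ x, finsupport (f' x) ⊆ finsupport (f x)) ∧
      ∀ σ ∈ B, ∀ x, ¬ σ ⊆ finsupport (f' x) := by
    intro B
    induction B using Finset.induction_on with
    | empty => exact fun _ => ⟨f, hf, hmem, fun x => subset_rfl, by simp⟩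
    | insert σ B _ ih =>
      intro hB
      obtain ⟨f₁, h1, h2, h3, h4⟩ := ih fun τ hτ => hB τ (Finset.mem_insert_of_mem hτ)
      obtain ⟨f₂, h5, h6, h7, h8⟩ :=
        exists_not_subset_finsupport hX h1 h2 (hB σ (Finset.mem_insert_self _ _))
      refine ⟨f₂, h5, h6, fun x => (h7 x).trans (h3 x), fun τ hτ x hs => ?_⟩
      rcases Finset.mem_insert.1 hτ with rfl | hτ
      · exact h8 x hs
      · exact h4 τ hτ x (hs.trans (h7 x))
  obtain ⟨f', h1, h2, h3, h4⟩ := key (Finset.powersetCard (k + 2) Finset.univ) fun σ hσ =>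
    (Finset.mem_powersetCard.1 hσ).2
  refine ⟨f', h1, h2, h3, fun x => ?_⟩
  by_contra! hlt
  obtain ⟨σ, hσ, hc⟩ := Finset.exists_subset_card_eq (show k + 2 ≤ _ from hlt)
  exact h4 σ (Finset.mem_powersetCard.2 ⟨Finset.subset_univ _, hc⟩) x hσ

/-- The geometric realization of a complex on a finite vertex set, as a subset of `V → ℝ`. -/
def realization {V : Type} [Fintype V] (K : Set (Finset V)) : Set (V → ℝ) :=
  {f | f ∈ stdSimplex ℝ V ∧ finsupport f ∈ K}

lemma single_mem_realization {V : Type} [Fintype V] [DecidableEq V] {K : Set (Finset V)} {v : V}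
    (h : {v} ∈ K) : Pi.single v (1 : ℝ) ∈ realization K := by
  refine ⟨single_mem_stdSimplex ℝ v, ?_⟩
  convert h
  ext w
  simp [mem_finsupport, Pi.single_apply]

lemma realization_mono {V : Type} [Fintype V] {K L : Set (Finset V)} (h : K ⊆ L) :
    realization K ⊆ realization L :=
  fun _ hf => ⟨hf.1, h hf.2⟩

lemma finsupport_add_subset {V : Type} [Fintype V] [DecidableEq V] (a b : ℝ) (f g : V → ℝ) :
    finsupport (a • f + b • g) ⊆ finsupport f ∪ finsupport g := by
  intro v hv
  rw [Finset.mem_union]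
  simp only [mem_finsupport] at hv ⊢
  by_contra! h
  exact hv (by simp [h.1, h.2])

lemma combo_mem_realization {V : Type} [Fintype V] [DecidableEq V] {K : Set (Finset V)}
    (hK : IsLowerSet K) {a b : ℝ} (ha : 0 ≤ a) (hb : 0 ≤ b) (hab : a + b = 1) {f g : V → ℝ}
    (hf : f ∈ stdSimplex ℝ V) (hg : g ∈ stdSimplex ℝ V)
    (h : finsupport f ∪ finsupport g ∈ K) : a • f + b • g ∈ realization K :=
  ⟨convex_stdSimplex ℝ V hf hg ha hb hab, hK (finsupport_add_subset a b f g) h⟩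

/-- Maps which are pointwise contained in a common simplex are homotopic. -/
theorem homotopic_of_union_mem {V X : Type} [Fintype V] [DecidableEq V] [TopologicalSpace X]
    {K : Set (Finset V)} (hK : IsLowerSet K) (f g : C(X, realization K))
    (h : ∀ x, finsupport (f x).1 ∪ finsupport (g x).1 ∈ K) : f.Homotopic g := by
  refine ⟨⟨⟨fun p => ⟨(1 - (p.1 : ℝ)) • (f p.2).1 + (p.1 : ℝ) • (g p.2).1,
    combo_mem_realization hK (sub_nonneg.2 p.1.2.2) p.1.2.1 (sub_add_cancel _ _)
      (f p.2).2.1 (g p.2).2.1 (h p.2)⟩, ?_⟩, fun x => ?_, fun x => ?_⟩⟩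
  · exact Continuous.subtype_mk (by fun_prop) _
  · ext1; simp
  · ext1; simp

/-- `n` counts connectivity: the realization is nonempty if `1 ≤ n`, and all maps to it from
compact metric spaces of dimension at most `n - 2` are nullhomotopic. -/
def MapConn {V : Type} [Fintype V] (n : ℕ) (K : Set (Finset V)) : Prop :=
  (1 ≤ n → (realization K).Nonempty) ∧
    ∀ k : ℕ, k + 2 ≤ n → ∀ (X : Type) [MetricSpace X] [CompactSpace X],
      dimH (univ : Set X) ≤ k → ∀ f : C(X, realization K), f.Nullhomotopic

theorem mapConn_zero {V : Type} [Fintype V] (K : Set (Finset V)) : MapConn 0 K :=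
  ⟨by simp, fun k hk => by omega⟩

/-- A cone is highly connected. -/
theorem mapConn_of_cone {V : Type} [Fintype V] [DecidableEq V] {K : Set (Finset V)}
    (hK : IsLowerSet K) {v : V} (hv0 : {v} ∈ K) (hv : ∀ s ∈ K, insert v s ∈ K) (n : ℕ) :
    MapConn n K := by
  refine ⟨fun _ => ⟨_, single_mem_realization hv0⟩, fun k _ X _ _ _ f =>
    ⟨⟨_, single_mem_realization hv0⟩, homotopic_of_union_mem hK _ _ fun x => ?_⟩⟩
  refine hK ?_ (hv _ (f x).2.2)
  intro w hw
  rw [Finset.mem_union] at hw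
  rcases hw with hw | hw
  · exact Finset.mem_insert_of_mem hw
  · rw [Finset.mem_insert]
    left
    by_contra hne
    simp [mem_finsupport, hne] at hw

/-- The `(k - 1)`-skeleton of the realization. -/
def skeleton {V : Type} [Fintype V] (K : Set (Finset V)) (k : ℕ) : Set (V → ℝ) :=
  {f | f ∈ realization K ∧ (finsupport f).card ≤ k}

lemma skeleton_eq_iUnion {V : Type} [Fintype V] {K : Set (Finset V)} (hK : IsLowerSet K) (k : ℕ) :
    skeleton K k = ⋃ s ∈ {s : Finset V | s ∈ K ∧ s.card ≤ k},
      {f | f ∈ stdSimplex ℝ V ∧ finsupport f ⊆ s} := by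
  ext f
  simp only [skeleton, realization, mem_ofPred_eq, mem_iUnion, exists_prop]
  constructor
  · rintro ⟨⟨h1, h2⟩, h3⟩
    exact ⟨_, ⟨h2, h3⟩, h1, subset_rfl⟩
  · rintro ⟨s, ⟨h1, h2⟩, h3, h4⟩
    exact ⟨⟨h3, hK h4 h1⟩, (Finset.card_le_card h4).trans h2⟩

lemma isCompact_skeleton {V : Type} [Fintype V] {K : Set (Finset V)} (hK : IsLowerSet K) (k : ℕ) :
    IsCompact (skeleton K k) := by
  rw [skeleton_eq_iUnion hK]
  refine (toFinite _).isCompact_biUnion fun s _ => ?_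
  have h : {f : V → ℝ | f ∈ stdSimplex ℝ V ∧ finsupport f ⊆ s} =
      stdSimplex ℝ V ∩ ⋂ v ∈ {v | v ∉ s}, {f | f v = 0} := by
    ext f
    simp only [mem_ofPred_eq, mem_inter_iff, mem_iInter, Finset.subset_iff, mem_finsupport]
    exact and_congr_right fun _ => forall_congr' fun v => by tauto
  rw [h]
  exact (isCompact_stdSimplex ℝ V).inter_right
    (isClosed_biInter fun v _ => isClosed_eq (continuous_apply v) continuous_const)

lemma dimH_skeleton_le {V : Type} [Fintype V] {K : Set (Finset V)} (hK : IsLowerSet K) (k : ℕ) :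
    dimH (skeleton K (k + 1)) ≤ k := by
  classical
  rw [skeleton_eq_iUnion hK, dimH_bUnion (to_countable _)]
  refine iSup₂_le fun s hs => ?_
  rcases s.eq_empty_or_nonempty with rfl | ⟨v₀, hv₀⟩
  · have : {f : V → ℝ | f ∈ stdSimplex ℝ V ∧ finsupport f ⊆ ∅} = ∅ := by
      refine eq_empty_of_forall_notMem fun f hf => ?_
      have h1 := sum_finsupport f
      rw [hf.1.2, Finset.subset_empty.1 hf.2] at h1
      simp at h1
    rw [this, dimH_empty]
    exact zero_le
  · let φ : (s.erase v₀ → ℝ) → V → ℝ := fun y v => if hv : v ∈ s.erase v₀ then y ⟨v, hv⟩ else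
      if v = v₀ then 1 - ∑ v, y v else 0
    have hφ : ContDiff ℝ 1 φ := by
      refine contDiff_pi.2 fun v => ?_
      simp only [φ]
      split_ifs <;> fun_prop
    have hsub : {f : V → ℝ | f ∈ stdSimplex ℝ V ∧ finsupport f ⊆ s} ⊆ range φ := by
      rintro f ⟨hf, hfs⟩
      refine ⟨fun v => f v, ?_⟩
      ext v
      simp only [φ]
      split_ifs with h1 h2
      · rfl
      · rw [Finset.sum_coe_sort (s.erase v₀) f, h2, sub_eq_iff_eq_add,
          Finset.add_sum_erase s f hv₀, ← hf.2]
        refine (Finset.sum_subset (Finset.subset_univ _) fun w _ hw => ?_).symm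
        by_contra h
        exact hw (hfs (mem_finsupport.2 h))
      · by_contra h
        exact h1 (Finset.mem_erase.2 ⟨h2, hfs (mem_finsupport.2 (Ne.symm h))⟩)
    refine (dimH_mono hsub).trans (hφ.dimH_range_le.trans ?_)
    rw [Module.finrank_fintype_fun_eq_card, Fintype.card_coe, Finset.card_erase_of_mem hv₀]
    have := hs.2
    exact_mod_cast (show s.card - 1 ≤ k by omega)

/-- In an `n`-connected realization, small skeleta contract. -/
theorem MapConn.skeleton_nullhomotopic {V : Type} [Fintype V] {K : Set (Finset V)}
    (hK : IsLowerSet K) {n k : ℕ} (h : MapConn n K) (hk : k + 1 ≤ n) :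
    (⟨fun z => ⟨z.1, z.2.1⟩, by fun_prop⟩ :
      C(skeleton K k, realization K)).Nullhomotopic := by
  cases k with
  | zero =>
    obtain ⟨y, hy⟩ := h.1 (by omega)
    have hempty : IsEmpty (skeleton K 0) := by
      refine ⟨fun z => ?_⟩
      have h1 := sum_finsupport z.1
      rw [z.2.1.1.2, Finset.card_eq_zero.1 (Nat.le_zero.1 z.2.2)] at h1
      simp at h1
    refine ⟨⟨y, hy⟩, ?_⟩
    convert ContinuousMap.Homotopic.refl _
  | succ k =>
    have := isCompact_iff_compactSpace.1 (isCompact_skeleton hK (k + 1))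
    refine h.2 k hk _ ?_ _
    rw [← isometry_subtype_coe.dimH_image, image_univ, Subtype.range_coe]
    exact dimH_skeleton_le hK k

/-- Compression of a map into the skeleton of the realization. -/
theorem exists_homotopic_skeleton {V X : Type} [Fintype V] [MetricSpace X] {k : ℕ}
    (hX : dimH (univ : Set X) ≤ k) {K : Set (Finset V)} (hK : IsLowerSet K)
    (f : C(X, realization K)) :
    ∃ f' : C(X, realization K), f.Homotopic f' ∧ ∀ x, (finsupport (f' x).1).card ≤ k + 1 := by
  classical
  obtain ⟨g, hg, h1, h2, h3⟩ := exists_card_finsupport_le hX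
    (continuous_subtype_val.comp f.continuous) fun x => (f x).2.1
  let f' : C(X, realization K) :=
    ⟨fun x => ⟨g x, h1 x, hK (h2 x) (f x).2.2⟩, hg.subtype_mk _⟩
  exact ⟨f', homotopic_of_union_mem hK _ _ fun x =>
    hK (Finset.union_subset subset_rfl (h2 x)) (f x).2.2, h3⟩

/-- Deletion–link criterion for connectivity. -/
theorem MapConn.of_deletion_link {V : Type} [Fintype V] [DecidableEq V] {K D L : Set (Finset V)}
    (hK : IsLowerSet K) (hL : IsLowerSet L) {v : V} {n : ℕ} (hv0 : {v} ∈ K) (hDK : D ⊆ K)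
    (hLD : L ⊆ D) (hLK : ∀ s ∈ L, insert v s ∈ K)
    (hKL : ∀ s ∈ K, v ∈ s → s.erase v ∈ L) (hKD : ∀ s ∈ K, v ∉ s → s ∈ D)
    (hD : MapConn (n + 1) D) (hLn : MapConn n L) : MapConn (n + 1) K := by
  refine ⟨fun _ => ⟨_, single_mem_realization hv0⟩, fun k hk X _ _ hX f => ?_⟩
  obtain ⟨f', hff', hcard⟩ := exists_homotopic_skeleton hX hK f
  obtain ⟨y₀, ⟨G⟩⟩ := hLn.skeleton_nullhomotopic hL (k := k) (by omega)
  have hG0 : ∀ z : skeleton L k, (G (0, z)).1 = z.1 := fun z =>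
    congrArg Subtype.val (G.apply_zero z)
  have hG1 : ∀ z : skeleton L k, G (1, z) = y₀ := fun z => G.apply_one z
  let e : V → ℝ := Pi.single v 1
  have he : e ∈ stdSimplex ℝ V := single_mem_stdSimplex ℝ v
  have hes : finsupport e ⊆ {v} := by
    intro w hw
    by_contra hne
    rw [Finset.mem_singleton] at hne
    simp [mem_finsupport, e, hne] at hw
  have hcone : ∀ z ∈ realization L, ∀ c : ℝ, 0 ≤ c → c ≤ 1 →
      (1 - c) • e + c • z ∈ realization K := fun z hz c h0 h1 =>
    combo_mem_realization hK (sub_nonneg.2 h1) h0 (sub_add_cancel _ _) he hz.1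
      (hK (by rw [Finset.insert_eq]; exact Finset.union_subset_union hes subset_rfl)
        (hLK _ hz.2))
  let w : X → ℝ := fun x => (f' x).1 v
  have hw : Continuous w :=
    (continuous_apply v).comp (continuous_subtype_val.comp f'.continuous)
  have hw0 : ∀ x, 0 ≤ w x := fun x => (f' x).2.1.1 v
  let y : X → V → ℝ := fun x => (max (1 / 2) (1 - w x))⁻¹ • ((f' x).1 - w x • e)
  have hm : ∀ x, (0 : ℝ) < max (1 / 2) (1 - w x) := fun x => by positivity
  have hy : Continuous y :=
    ((continuous_const.max (continuous_const.sub hw)).inv₀ fun x => (hm x).ne').smul (by fun_prop)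
  have hyv : ∀ x, y x v = 0 := fun x => by simp [y, e, w]
  have hys : ∀ x, finsupport (y x) ⊆ (finsupport (f' x).1).erase v := by
    intro x u hu
    rw [mem_finsupport] at hu
    have huv : u ≠ v := by rintro rfl; exact hu (hyv x)
    refine Finset.mem_erase.2 ⟨huv, mem_finsupport.2 fun h => hu ?_⟩
    simp [y, e, huv, h]
  have hyf : ∀ x, w x = 0 → y x = (f' x).1 := fun x h => by
    have : max (2 : ℝ)⁻¹ 1 = 1 := by norm_num
    simp [y, h, this]
  have hyZ : ∀ x, 0 < w x → w x ≤ 1 / 2 → y x ∈ skeleton L k := by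
    intro x h0 h1
    have hvs : v ∈ finsupport (f' x).1 := mem_finsupport.2 h0.ne'
    have hmax : max (1 / 2) (1 - w x) = 1 - w x := max_eq_right (by linarith)
    refine ⟨⟨⟨fun u => ?_, ?_⟩, hL (hys x) (hKL _ (f' x).2.2 hvs)⟩, ?_⟩
    · by_cases huv : u = v
      · rw [huv, hyv]
      · simp only [y, Pi.smul_apply, Pi.sub_apply, e, Pi.single_eq_of_ne huv, smul_eq_mul,
          mul_zero, sub_zero]
        exact mul_nonneg (inv_nonneg.2 (hm x).le) ((f' x).2.1.1 u)
    · have h2 := (f' x).2.1.2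
      have h3 := he.2
      simp only [y, Pi.smul_apply, Pi.sub_apply, smul_eq_mul]
      rw [← Finset.mul_sum, Finset.sum_sub_distrib, ← Finset.mul_sum, h2, h3, mul_one, hmax]
      exact inv_mul_cancel₀ (by linarith)
    · have h2 := Finset.card_le_card (hys x)
      rw [Finset.card_erase_of_mem hvs] at h2
      have := hcard x
      omega
  let T : Set X := {x | w x ≤ 1 / 2 ∧ y x ∈ skeleton L k}
  have hT : IsClosed T := (isClosed_le hw continuous_const).inter
    ((isCompact_skeleton hL k).isClosed.preimage hy)
  let lam : X × unitInterval → ℝ := fun p => (1 - 2 * w p.1) + 2 * w p.1 * max (2 * (p.2 : ℝ) - 1) 0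
  let sig : X × unitInterval → ℝ := fun p => (1 - 2 * w p.1) + 2 * w p.1 * max (1 - 2 * (p.2 : ℝ)) 0
  have hlam : Continuous lam := by fun_prop
  have hsig : Continuous sig := by fun_prop
  have hlam0 : ∀ p : X × unitInterval, w p.1 ≤ 1 / 2 → 0 ≤ lam p := fun p h =>
    add_nonneg (by linarith) (mul_nonneg (by linarith [hw0 p.1]) (le_max_right _ _))
  have hlam1 : ∀ p : X × unitInterval, lam p ≤ 1 := fun p => by
    have h1 : max (2 * (p.2 : ℝ) - 1) 0 ≤ 1 := max_le (by linarith [p.2.2.2]) zero_le_one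
    have h2 := mul_le_mul_of_nonneg_left h1 (show 0 ≤ 2 * w p.1 by linarith [hw0 p.1])
    simp only [lam]; linarith
  let A : X × unitInterval → V → ℝ := fun p =>
    open Classical in if h : p.1 ∈ T then (1 - lam p) • e +
      lam p • (G (projIcc 0 1 zero_le_one (1 - sig p), ⟨y p.1, h.2⟩)).1
    else if w p.1 = 0 then (f' p.1).1
    else (1 - max (2 * (p.2 : ℝ) - 1) 0) • e + max (2 * (p.2 : ℝ) - 1) 0 • y₀.1
  have hAT : ∀ p (h : p.1 ∈ T), A p = (1 - lam p) • e +
      lam p • (G (projIcc 0 1 zero_le_one (1 - sig p), ⟨y p.1, h.2⟩)).1 := fun p h => dif_pos h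
  have hA0 : ∀ p : X × unitInterval, w p.1 = 0 → A p = (f' p.1).1 := by
    intro p h0
    by_cases h : p.1 ∈ T
    · rw [hAT p h]
      have h1 : lam p = 1 := by simp [lam, h0]
      have h2 : sig p = 1 := by simp [sig, h0]
      rw [h1, h2, sub_self, projIcc_left, zero_smul, one_smul, zero_add]
      exact (hG0 _).trans (hyf _ h0)
    · simp only [A, dif_neg h, if_pos h0]
  have hA2 : ∀ p : X × unitInterval, 1 / 2 ≤ w p.1 → A p =
      (1 - max (2 * (p.2 : ℝ) - 1) 0) • e + max (2 * (p.2 : ℝ) - 1) 0 • y₀.1 := by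
    intro p h0
    by_cases h : p.1 ∈ T
    · have hwp : w p.1 = 1 / 2 := le_antisymm h.1 h0
      rw [hAT p h]
      have h1 : lam p = max (2 * (p.2 : ℝ) - 1) 0 := by simp [lam, hwp]
      have h2 : sig p = max (1 - 2 * (p.2 : ℝ)) 0 := by simp [sig, hwp]
      rw [h1]
      rcases le_total (p.2 : ℝ) (1 / 2) with h3 | h3
      · rw [max_eq_right (by linarith : 2 * (p.2 : ℝ) - 1 ≤ 0), zero_smul, zero_smul]
      · rw [h2, max_eq_right (by linarith : 1 - 2 * (p.2 : ℝ) ≤ 0), sub_zero, projIcc_right]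
        exact congrArg (fun z : realization L => _ + _ • z.1) (hG1 _)
    · have hne : w p.1 ≠ 0 := by linarith
      simp only [A, dif_neg h, if_neg hne]
  have hcases : ∀ x, x ∈ T ∨ w x = 0 ∨ 1 / 2 ≤ w x := by
    intro x
    rcases (hw0 x).eq_or_lt with h | h
    · exact Or.inr (Or.inl h.symm)
    · rcases le_total (w x) (1 / 2) with h1 | h1
      · exact Or.inl ⟨h1, hyZ x h h1⟩
      · exact Or.inr (Or.inr h1)
  have hAK : ∀ p, A p ∈ realization K := by
    intro p
    rcases hcases p.1 with h | h | h
    · rw [hAT p h]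
      exact hcone _ (Subtype.mem _) _ (hlam0 p h.1) (hlam1 p)
    · rw [hA0 p h]; exact (f' p.1).2
    · rw [hA2 p h]
      exact hcone _ y₀.2 _ (le_max_right _ _) (max_le (by linarith [p.2.2.2]) zero_le_one)
  have hAc : Continuous A := by
    have hS : IsClosed (Prod.fst ⁻¹' T : Set (X × unitInterval)) := hT.preimage continuous_fst
    have hS0 : IsClosed {p : X × unitInterval | w p.1 = 0} :=
      isClosed_eq (by fun_prop) continuous_const
    have hS2 : IsClosed {p : X × unitInterval | 1 / 2 ≤ w p.1} :=
      isClosed_le continuous_const (by fun_prop)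
    have hcT : ContinuousOn A (Prod.fst ⁻¹' T) := by
      rw [continuousOn_iff_continuous_domRestrict]
      have h1 : (Prod.fst ⁻¹' T).domRestrict A = fun p : (Prod.fst ⁻¹' T : Set (X × unitInterval)) =>
          (1 - lam p.1) • e + lam p.1 •
            (G (projIcc 0 1 zero_le_one (1 - sig p.1), ⟨y p.1.1, p.2.2⟩)).1 :=
        funext fun p => hAT p.1 p.2
      rw [h1]
      have h2 : Continuous fun p : (Prod.fst ⁻¹' T : Set (X × unitInterval)) =>
          (⟨y p.1.1, p.2.2⟩ : skeleton L k) := Continuous.subtype_mk (by fun_prop) _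
      have h3 : Continuous fun p : (Prod.fst ⁻¹' T : Set (X × unitInterval)) =>
          projIcc (0 : ℝ) 1 zero_le_one (1 - sig p.1) := continuous_projIcc.comp (by fun_prop)
      have h4 := continuous_subtype_val.comp (G.continuous.comp (h3.prodMk h2))
      have h5 : Continuous fun p : (Prod.fst ⁻¹' T : Set (X × unitInterval)) =>
          (1 - lam p.1) • e := by fun_prop
      have h6 : Continuous fun p : (Prod.fst ⁻¹' T : Set (X × unitInterval)) => lam p.1 := by
        fun_prop
      exact h5.add (h6.smul h4)
    have hc0 : ContinuousOn A {p | w p.1 = 0} :=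
      ContinuousOn.congr (f := fun p : X × unitInterval => (f' p.1).1) (by fun_prop)
        fun p hp => hA0 p hp
    have hc2 : ContinuousOn A {p | 1 / 2 ≤ w p.1} :=
      ContinuousOn.congr (f := fun p : X × unitInterval =>
        (1 - max (2 * (p.2 : ℝ) - 1) 0) • e + max (2 * (p.2 : ℝ) - 1) 0 • y₀.1) (by fun_prop)
        fun p hp => hA2 p hp
    rw [← continuousOn_univ]
    refine ((hcT.union_of_isClosed hc0 hS hS0).union_of_isClosed hc2 (hS.union hS0) hS2).mono
      fun p _ => ?_
    rcases hcases p.1 with h | h | h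
    exacts [Or.inl (Or.inl h), Or.inl (Or.inr h), Or.inr h]
  let f₁ : C(X, realization K) := ⟨fun x => ⟨A (x, 0), hAK _⟩, by fun_prop⟩
  have hf₁ : f'.Homotopic f₁ := by
    refine homotopic_of_union_mem hK _ _ fun x =>
      hK (Finset.union_subset subset_rfl ?_) (f' x).2.2
    change finsupport (A (x, 0)) ⊆ _
    by_cases h0 : w x = 0
    · rw [hA0 _ h0]
    have hve : finsupport e ⊆ finsupport (f' x).1 :=
      hes.trans (Finset.singleton_subset_iff.2 (mem_finsupport.2 h0))
    rcases hcases x with h | h | h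
    · rw [hAT (x, 0) h]
      have h1 : sig (x, 0) = 1 := by simp [sig]
      rw [h1, sub_self, projIcc_left]
      change finsupport (_ + _ • (G (0, ⟨y x, h.2⟩)).1) ⊆ _
      rw [hG0]
      exact (finsupport_add_subset _ _ _ _).trans (Finset.union_subset hve
        ((hys x).trans (Finset.erase_subset _ _)))
    · exact absurd h h0
    · rw [hA2 (x, 0) h]
      have h1 : max (2 * ((0 : unitInterval) : ℝ) - 1) 0 = 0 := by simp
      simp only [h1, sub_zero, one_smul, zero_smul, add_zero]
      exact hve
  have hAD : ∀ x, A (x, 1) ∈ realization D := by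
    have hm1 : max (2 * ((1 : unitInterval) : ℝ) - 1) 0 = 1 := by
      rw [Icc.coe_one]; norm_num
    intro x
    rcases hcases x with h | h | h
    · rw [hAT (x, 1) h]
      have h1 : lam (x, 1) = 1 := by simp only [lam, hm1]; ring
      rw [h1, sub_self, zero_smul, one_smul, zero_add]
      exact realization_mono hLD (Subtype.mem _)
    · rw [hA0 (x, 1) h]
      exact ⟨(f' x).2.1, hKD _ (f' x).2.2 fun hv => mem_finsupport.1 hv h⟩
    · rw [hA2 (x, 1) h]
      simp only [hm1, sub_self, one_smul, zero_smul, zero_add]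
      exact realization_mono hLD y₀.2
  let r : C(X, realization D) := ⟨fun x => ⟨A (x, 1), hAD x⟩, by fun_prop⟩
  let i : C(realization D, realization K) :=
    ⟨fun z => ⟨z.1, realization_mono hDK z.2⟩, by fun_prop⟩
  have hr : f₁.Homotopic (i.comp r) :=
    ⟨⟨⟨fun p => ⟨A (p.2, p.1), hAK _⟩, by fun_prop⟩, fun x => rfl, fun x => rfl⟩⟩
  obtain ⟨z, hz⟩ := (hD.2 k hk X hX r).comp_right i
  exact ⟨z, ((hff'.trans hf₁).trans hr).trans hz⟩

/-- The complex of subsets of `S` whose distinct elements are pairwise unrelated. -/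
def freeSets {V : Type} (R : V → V → Prop) (S : Finset V) : Set (Finset V) :=
  {s | s ⊆ S ∧ ∀ a ∈ s, ∀ b ∈ s, a ≠ b → ¬ R a b}

theorem isLowerSet_freeSets {V : Type} (R : V → V → Prop) (S : Finset V) :
    IsLowerSet (freeSets R S) := fun _ _ hts hs =>
  ⟨hts.trans hs.1, fun a ha b hb => hs.2 a (hts ha) b (hts hb)⟩

/-- `Peel R S k` certifies, by successive deletions of vertices, that the complex
`freeSets R S` is `(k - 2)`-connected. -/
inductive Peel {V : Type} (R : V → V → Prop) : Finset V → ℕ → Prop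
  | zero (S : Finset V) : Peel R S 0
  | isolated {S : Finset V} {v : V} (hv : v ∈ S) (h : ∀ w ∈ S, w ≠ v → ¬ R v w) (k : ℕ) :
      Peel R S k
  | step {S D L : Finset V} {v : V} {k : ℕ} (hv : v ∈ S) (hD : ∀ w, w ∈ D ↔ w ∈ S ∧ w ≠ v)
      (hL : ∀ w, w ∈ L ↔ w ∈ S ∧ w ≠ v ∧ ¬ R v w) (h₁ : Peel R D (k + 1)) (h₂ : Peel R L k) :
      Peel R S (k + 1)

theorem Peel.mapConn {V : Type} [Fintype V] [DecidableEq V] {R : V → V → Prop}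
    (hR : ∀ a b, R a b → R b a) {S : Finset V} {k : ℕ} (h : Peel R S k) :
    MapConn k (freeSets R S) := by
  have hsing : ∀ {S : Finset V} {v : V}, v ∈ S → {v} ∈ freeSets R S := fun hv =>
    ⟨Finset.singleton_subset_iff.2 hv, fun a ha b hb hab => absurd
      ((Finset.mem_singleton.1 ha).trans (Finset.mem_singleton.1 hb).symm) hab⟩
  have hins : ∀ {S s : Finset V} {v : V}, v ∈ S → s ∈ freeSets R S →
      (∀ w ∈ s, w ≠ v → ¬ R v w) → insert v s ∈ freeSets R S := by
    intro S s v hv hs h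
    refine ⟨Finset.insert_subset hv hs.1, fun a ha b hb hab => ?_⟩
    rcases Finset.mem_insert.1 ha with rfl | has <;> rcases Finset.mem_insert.1 hb with rfl | hbs
    · exact absurd rfl hab
    · exact h b hbs hab.symm
    · exact fun hr => h a has hab (hR _ _ hr)
    · exact hs.2 a has b hbs hab
  induction h with
  | zero S => exact mapConn_zero _
  | isolated hv h k =>
    exact mapConn_of_cone (isLowerSet_freeSets R _) (hsing hv)
      (fun s hs => hins hv hs fun w hw => h w (hs.1 hw)) k
  | step hv hD hL _ _ ih₁ ih₂ =>
    refine MapConn.of_deletion_link (isLowerSet_freeSets R _) (isLowerSet_freeSets R _)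
      (hsing hv) ?_ ?_ ?_ ?_ ?_ ih₁ ih₂
    · exact fun s hs => ⟨fun w hw => ((hD w).1 (hs.1 hw)).1, hs.2⟩
    · exact fun s hs => ⟨fun w hw => (hD w).2
        ⟨((hL w).1 (hs.1 hw)).1, ((hL w).1 (hs.1 hw)).2.1⟩, hs.2⟩
    · exact fun s hs => hins hv ⟨fun w hw => ((hL w).1 (hs.1 hw)).1, hs.2⟩
        fun w hw _ => ((hL w).1 (hs.1 hw)).2.2
    · intro s hs hvs
      refine ⟨fun w hw => ?_, fun a ha b hb => hs.2 a (Finset.mem_of_mem_erase ha) b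
        (Finset.mem_of_mem_erase hb)⟩
      obtain ⟨hwv, hws⟩ := Finset.mem_erase.1 hw
      exact (hL w).2 ⟨hs.1 hws, hwv, hs.2 _ hvs w hws hwv.symm⟩
    · exact fun s hs hvs => ⟨fun w hw => (hD w).2 ⟨hs.1 hw, fun h => hvs (h ▸ hw)⟩, hs.2⟩

theorem Peel.map {V W : Type} {R : V → V → Prop} {R' : W → W → Prop} {φ : V → W} {S : Finset V}
    {k : ℕ} (h : Peel R S k) (hφ : ∀ a ∈ S, ∀ b ∈ S, φ a = φ b → a = b)
    (hR : ∀ a ∈ S, ∀ b ∈ S, a ≠ b → (R' (φ a) (φ b) ↔ R a b)) [DecidableEq W] :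
    Peel R' (S.image φ) k := by
  induction h with
  | zero S => exact .zero _
  | isolated hv h k =>
    refine .isolated (Finset.mem_image_of_mem φ hv) ?_ k
    simp only [Finset.forall_mem_image]
    exact fun w hw hwv hr => have hne := fun h => hwv (congrArg φ h)
      h w hw hne ((hR _ hv _ hw (Ne.symm hne)).1 hr)
  | @step S D L v k hv hD hL _ _ ih₁ ih₂ =>
    have hDS : ∀ w ∈ D, w ∈ S := fun w hw => ((hD w).1 hw).1
    have hLS : ∀ w ∈ L, w ∈ S := fun w hw => ((hL w).1 hw).1
    refine .step (Finset.mem_image_of_mem φ hv) (fun w => ?_) (fun w => ?_)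
      (ih₁ (fun a ha b hb => hφ a (hDS a ha) b (hDS b hb))
        fun a ha b hb => hR a (hDS a ha) b (hDS b hb))
      (ih₂ (fun a ha b hb => hφ a (hLS a ha) b (hLS b hb))
        fun a ha b hb => hR a (hLS a ha) b (hLS b hb))
    · simp only [Finset.mem_image]
      constructor
      · rintro ⟨a, ha, rfl⟩
        exact ⟨⟨a, hDS a ha, rfl⟩, fun h => ((hD a).1 ha).2 (hφ a (hDS a ha) v hv h)⟩
      · rintro ⟨⟨a, ha, rfl⟩, hne⟩
        exact ⟨a, (hD a).2 ⟨ha, fun h => hne (h ▸ rfl)⟩, rfl⟩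
    · simp only [Finset.mem_image]
      constructor
      · rintro ⟨a, ha, rfl⟩
        exact ⟨⟨a, hLS a ha, rfl⟩, fun h => ((hL a).1 ha).2.1 (hφ a (hLS a ha) v hv h),
          fun h => ((hL a).1 ha).2.2
            ((hR v hv a (hLS a ha) ((hL a).1 ha).2.1.symm).1 h)⟩
      · rintro ⟨⟨a, ha, rfl⟩, hne, hr⟩
        have hav : a ≠ v := fun h => hne (h ▸ rfl)
        exact ⟨a, (hL a).2 ⟨ha, hav, fun h => hr ((hR v hv a ha hav.symm).2 h)⟩, rfl⟩

theorem Peel.mono {V : Type} {R : V → V → Prop} {S : Finset V} {k : ℕ} (h : Peel R S k) :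
    ∀ {j : ℕ}, j ≤ k → Peel R S j := by
  induction h with
  | zero S => intro j hj; rw [Nat.le_zero.1 hj]; exact .zero S
  | isolated hv h k => exact fun _ => .isolated hv h _
  | step hv hD hL _ _ ih₁ ih₂ =>
    intro j hj
    cases j with
    | zero => exact .zero _
    | succ j => exact .step hv hD hL (ih₁ hj) (ih₂ (by omega))

/-- A vertex `v` may be removed if its link is a cone with apex `w`. -/
theorem Peel.of_delete {V : Type} [DecidableEq V] {R : V → V → Prop} {S D : Finset V} {k : ℕ}
    (v w : V) (hv : v ∈ S) (hw : w ∈ S) (hwv : w ≠ v) (hvw : ¬ R v w)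
    (h : ∀ x ∈ S, x ≠ w → R w x → x = v ∨ R v x) (hD : ∀ x, x ∈ D ↔ x ∈ S ∧ x ≠ v)
    (hP : Peel R D k) : Peel R S k := by
  classical
  cases k with
  | zero => exact .zero _
  | succ k =>
    refine .step (L := S.filter fun x => x ≠ v ∧ ¬ R v x) hv hD (fun x => by simp) hP
      (.isolated (v := w) (by simp [hw, hwv, hvw]) (fun x hx hxw hr => ?_) k)
    simp only [Finset.mem_filter] at hx
    exact (h x hx.1 hxw hr).elim hx.2.1 hx.2.2

/-- If `w` has `v` as its only neighbour, then only the link of `v` matters. -/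
theorem Peel.of_link {V : Type} [DecidableEq V] {R : V → V → Prop} {S L : Finset V} {k : ℕ}
    (v w : V) (hv : v ∈ S) (hw : w ∈ S) (hwv : w ≠ v)
    (h : ∀ x ∈ S, x ≠ w → R w x → x = v) (hL : ∀ x, x ∈ L ↔ x ∈ S ∧ x ≠ v ∧ ¬ R v x)
    (hP : Peel R L k) : Peel R S (k + 1) := by
  classical
  refine .step (D := S.erase v) hv (fun x => by simp [and_comm]) hL
    (.isolated (v := w) (by simp [hw, hwv]) (fun x hx hxw hr => ?_) _) hP
  exact (Finset.mem_erase.1 hx).1 (h x (Finset.mem_erase.1 hx).2 hxw hr)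

theorem dimH_sphere_le (i : ℕ) :
    dimH (univ : Set (sphere (0 : EuclideanSpace ℝ (Fin (i + 1))) 1)) ≤ i := by
  let v : EuclideanSpace ℝ (Fin (i + 1)) := EuclideanSpace.single 0 1
  have hv : ‖v‖ = 1 := by simp [v]
  rw [← isometry_subtype_coe.dimH_image, image_univ, Subtype.range_coe]
  have hsub : sphere (0 : EuclideanSpace ℝ (Fin (i + 1))) 1 ⊆
      {v} ∪ range fun w : (ℝ ∙ v)ᗮ => stereoInvFunAux v (w : EuclideanSpace ℝ (Fin (i + 1))) := by
    intro x hx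
    by_cases hxv : x = v
    · exact Or.inl hxv
    · refine Or.inr ⟨stereoToFun v x, ?_⟩
      have := stereo_left_inv hv (x := ⟨x, hx⟩) hxv
      exact congrArg Subtype.val this
  refine (dimH_mono hsub).trans ?_
  rw [dimH_union, dimH_singleton, max_eq_right zero_le]
  have : Fact (Module.finrank ℝ (EuclideanSpace ℝ (Fin (i + 1))) = i + 1) := ⟨by simp⟩
  have hf : Module.finrank ℝ (ℝ ∙ v)ᗮ = i :=
    Submodule.finrank_orthogonal_span_singleton (by intro h; simp [h] at hv)
  have hd : ContDiff ℝ 1 fun w : (ℝ ∙ v)ᗮ =>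
      stereoInvFunAux v (w : EuclideanSpace ℝ (Fin (i + 1))) :=
    contDiff_stereoInvFunAux.comp (ℝ ∙ v)ᗮ.subtypeL.contDiff
  have := hd.dimH_range_le
  rwa [hf] at this

/-- The geometric realization of a finite complex, in barycentric coordinates. -/
lemma mem_realization_iff {V : Type} [Fintype V] {K : Set (Finset V)} (hK : IsLowerSet K)
    (f : V → ℝ) : f ∈ realization K ↔
      (∃ s ∈ K, ∀ v, f v ≠ 0 → v ∈ s) ∧ (∀ v, 0 ≤ f v) ∧ ∑ᶠ v, f v = 1 := by
  rw [finsum_eq_sum_of_fintype]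
  constructor
  · rintro ⟨⟨h0, h1⟩, h2⟩
    exact ⟨⟨_, h2, fun v hv => mem_finsupport.2 hv⟩, h0, h1⟩
  · rintro ⟨⟨s, hs, h⟩, h0, h1⟩
    exact ⟨⟨h0, h1⟩, hK (fun v hv => h v (mem_finsupport.1 hv)) hs⟩

theorem MapConn.isConn {V : Type} [Fintype V] {K : Set (Finset V)} (hK : IsLowerSet K) {n : ℕ}
    (h : MapConn (n + 1) K) : IsConn (geom K) ((n : ℤ) - 1) := by
  let φ : C(geom K, realization K) :=
    ⟨fun f => ⟨f.1, (mem_realization_iff hK _).2 f.2⟩, continuous_subtype_val.subtype_mk _⟩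
  let ψ : C(realization K, geom K) :=
    ⟨fun f => ⟨f.1, (mem_realization_iff hK _).1 f.2⟩, continuous_subtype_val.subtype_mk _⟩
  refine ⟨fun _ => (h.1 (by omega)).to_subtype.map ψ, fun i hi f => ?_⟩
  let f' : C(sphere (0 : EuclideanSpace ℝ (Fin (i + 1))) 1, realization K) := φ.comp f
  obtain ⟨y, hy⟩ := h.2 i (by omega) _ (dimH_sphere_le i) f'
  exact ⟨ψ y, ContinuousMap.Homotopic.comp (.refl ψ) hy⟩

end

/-- Incidence of edges of the tiling by hexagons, the edges being numbered from left to right. -/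
def edgeRelAux (x y : ℕ) : Prop :=
  (x % 5 = 0 ∧ (y = x + 1 ∨ y = x + 3)) ∨ (x % 5 = 1 ∧ y = x + 1) ∨
  (x % 5 = 2 ∧ (y = x + 3 ∨ y = x + 4)) ∨ (x % 5 = 3 ∧ y = x + 1) ∨
  (x % 5 = 4 ∧ (y = x + 1 ∨ y = x + 4))

/-- The symmetric closure of `edgeRelAux`. -/
def edgeRel (x y : ℕ) : Prop := edgeRelAux x y ∨ edgeRelAux y x

lemma edgeRel_of_mod_zero {m : ℕ} (h : m % 5 = 0) (x : ℕ) :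
    edgeRel m x ↔ x = m + 1 ∨ x = m + 3 ∨ x + 3 = m ∨ x + 1 = m := by
  unfold edgeRel edgeRelAux
  omega

lemma edgeRel_of_mod_one {m : ℕ} (h : m % 5 = 1) (x : ℕ) :
    edgeRel m x ↔ x + 1 = m ∨ x = m + 1 ∨ x + 4 = m := by
  unfold edgeRel edgeRelAux
  omega

lemma edgeRel_of_mod_two {m : ℕ} (h : m % 5 = 2) (x : ℕ) :
    edgeRel m x ↔ x + 1 = m ∨ x = m + 3 ∨ x = m + 4 := by
  unfold edgeRel edgeRelAux
  omega

lemma edgeRel_of_mod_three {m : ℕ} (h : m % 5 = 3) (x : ℕ) :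
    edgeRel m x ↔ x + 3 = m ∨ x = m + 1 ∨ x + 4 = m := by
  unfold edgeRel edgeRelAux
  omega

lemma edgeRel_of_mod_four {m : ℕ} (h : m % 5 = 4) (x : ℕ) :
    edgeRel m x ↔ x + 1 = m ∨ x = m + 1 ∨ x = m + 4 := by
  unfold edgeRel edgeRelAux
  omega

theorem peel_edgeRel (t d : ℕ) :
    (∀ i, i + d = t → ∀ S : Finset ℕ, (∀ x, x ∈ S ↔ 5 * i ≤ x ∧ x ≤ 5 * t) →
      Peel edgeRel S (d + 1)) ∧
    (∀ i, i + 1 + d = t → ∀ S : Finset ℕ,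
      (∀ x, x ∈ S ↔ x = 5 * i + 2 ∨ x = 5 * i + 4 ∨ 5 * i + 5 ≤ x ∧ x ≤ 5 * t) →
      Peel edgeRel S (d + 1)) := by
  classical
  induction d using Nat.strong_induction_on with
  | _ d ih =>
  constructor
  · intro i hi S hS
    have e0 := edgeRel_of_mod_zero (m := 5 * i) (by omega)
    have e1 := edgeRel_of_mod_one (m := 5 * i + 1) (by omega)
    have e2 := edgeRel_of_mod_two (m := 5 * i + 2) (by omega)
    have e3 := edgeRel_of_mod_three (m := 5 * i + 3) (by omega)
    have e4 := edgeRel_of_mod_four (m := 5 * i + 4) (by omega)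
    have e5 := edgeRel_of_mod_zero (m := 5 * i + 5) (by omega)
    have e6 := edgeRel_of_mod_one (m := 5 * i + 6) (by omega)
    have e8 := edgeRel_of_mod_three (m := 5 * i + 8) (by omega)
    rcases Nat.eq_zero_or_pos d with rfl | hd
    · refine .isolated (v := 5 * i) ((hS _).2 (by omega)) (fun w hw hwv => ?_) _
      have := (hS w).1 hw
      omega
    obtain ⟨d, rfl⟩ : ∃ e, d = e + 1 := ⟨d - 1, by omega⟩
    refine .step (v := 5 * i) (D := S.filter fun x => x ≠ 5 * i)
      (L := S.filter fun x => x ≠ 5 * i ∧ ¬ edgeRel (5 * i) x) ((hS _).2 (by omega))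
      (fun x => by simp) (fun x => by simp) ?_ ((ih d (by omega)).2 i (by omega) _ ?_)
    swap
    · intro x
      grind
    refine .of_delete (5 * i + 5) (5 * i + 1) (D := S.filter fun x => x ≠ 5 * i ∧ x ≠ 5 * i + 5)
      ?_ ?_ ?_ ?_ ?_ ?_ ?_
    iterate 6
      grind
    by_cases hd0 : d = 0
    · subst hd0
      refine .of_link (5 * i + 1) (5 * i + 2)
        (L := S.filter fun x => x = 5 * i + 3 ∨ x = 5 * i + 4) ?_ ?_ ?_ ?_ ?_ ?_
      iterate 5
        grind
      refine .of_link (5 * i + 3) (5 * i + 4) (L := ∅) ?_ ?_ ?_ ?_ ?_ (.zero _)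
      iterate 4
        grind
      grind
    refine .of_delete (5 * i + 6) (5 * i + 1)
      (D := S.filter fun x => x ≠ 5 * i ∧ x ≠ 5 * i + 5 ∧ x ≠ 5 * i + 6) ?_ ?_ ?_ ?_ ?_ ?_ ?_
    iterate 6
      grind
    refine .of_delete (5 * i + 8) (5 * i + 3)
      (D := S.filter fun x => x ≠ 5 * i ∧ x ≠ 5 * i + 5 ∧ x ≠ 5 * i + 6 ∧ x ≠ 5 * i + 8)
      ?_ ?_ ?_ ?_ ?_ ?_ ?_
    iterate 6
      grind
    refine .of_link (5 * i + 1) (5 * i + 2)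
      (L := S.filter fun x => x = 5 * i + 3 ∨ x = 5 * i + 4 ∨ x = 5 * i + 7 ∨ 5 * i + 9 ≤ x)
      ?_ ?_ ?_ ?_ ?_ ?_
    iterate 5
      grind
    refine .of_link (5 * i + 3) (5 * i + 4)
      (L := S.filter fun x => x = 5 * i + 7 ∨ 5 * i + 9 ≤ x) ?_ ?_ ?_ ?_ ?_ ?_
    iterate 5
      grind
    obtain ⟨d, rfl⟩ : ∃ e, d = e + 1 := ⟨d - 1, by omega⟩
    refine (ih d (by omega)).2 (i + 1) (by omega) _ fun x => ?_
    grind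
  · intro i hi S hS
    have e2 := edgeRel_of_mod_two (m := 5 * i + 2) (by omega)
    have e4 := edgeRel_of_mod_four (m := 5 * i + 4) (by omega)
    have e5 := edgeRel_of_mod_zero (m := 5 * i + 5) (by omega)
    have e6 := edgeRel_of_mod_one (m := 5 * i + 6) (by omega)
    have e7 := edgeRel_of_mod_two (m := 5 * i + 7) (by omega)
    have e8 := edgeRel_of_mod_three (m := 5 * i + 8) (by omega)
    have e9 := edgeRel_of_mod_four (m := 5 * i + 9) (by omega)
    rcases Nat.eq_zero_or_pos d with rfl | hd
    · refine .step (v := 5 * i + 5) (D := S.filter fun x => x ≠ 5 * i + 5) (L := ∅)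
        ((hS _).2 (by omega)) (fun x => by simp) (fun x => ?_)
        (.isolated (v := 5 * i + 2) ?_ (fun x hx hxv => ?_) _) (.zero _)
      · grind
      · grind
      · simp only [Finset.mem_filter, hS] at hx
        grind
    obtain ⟨d, rfl⟩ : ∃ e, d = e + 1 := ⟨d - 1, by omega⟩
    refine .step (v := 5 * i + 5) (D := S.filter fun x => x ≠ 5 * i + 5)
      (L := S.filter fun x => x ≠ 5 * i + 5 ∧ ¬ edgeRel (5 * i + 5) x) ((hS _).2 (by omega))
      (fun x => by simp) (fun x => by simp) ?_
      ((ih d (by omega)).2 (i + 1) (by omega) _ ?_)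
    swap
    · intro x
      grind
    refine .of_delete (5 * i + 7) (5 * i + 2)
      (D := S.filter fun x => x ≠ 5 * i + 5 ∧ x ≠ 5 * i + 7) ?_ ?_ ?_ ?_ ?_ ?_ ?_
    iterate 6
      grind
    refine .of_delete (5 * i + 9) (5 * i + 4)
      (D := S.filter fun x => x ≠ 5 * i + 5 ∧ x ≠ 5 * i + 7 ∧ x ≠ 5 * i + 9) ?_ ?_ ?_ ?_ ?_ ?_ ?_
    iterate 6
      grind
    refine .of_link (5 * i + 2) (5 * i + 6)
      (L := S.filter fun x => x = 5 * i + 4 ∨ x = 5 * i + 8 ∨ 5 * i + 10 ≤ x) ?_ ?_ ?_ ?_ ?_ ?_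
    iterate 5
      grind
    refine .of_link (5 * i + 4) (5 * i + 8)
      (L := S.filter fun x => 5 * i + 10 ≤ x) ?_ ?_ ?_ ?_ ?_ ?_
    iterate 5
      grind
    refine ((ih d (by omega)).1 (i + 2) (by omega) _ fun x => ?_).mono (Nat.le_succ d)
    grind

section

open Set

/-- The endpoints of the `x`-th edge of the tiling by hexagons. -/
def edgeEnds (x : ℕ) : PV × PV :=
  if x % 5 = 0 then (.u (x / 5), .v (x / 5))
  else if x % 5 = 1 then (.u (x / 5), .p (x / 5 + 1) 1)
  else if x % 5 = 2 then (.p (x / 5 + 1) 1, .u (x / 5 + 1))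
  else if x % 5 = 3 then (.v (x / 5), .q (x / 5 + 1) 1)
  else (.q (x / 5 + 1) 1, .v (x / 5 + 1))

lemma edgeEnds_zero (i : ℕ) : edgeEnds (5 * i) = (.u i, .v i) := by
  simp [edgeEnds]

lemma edgeEnds_one (i : ℕ) : edgeEnds (5 * i + 1) = (.u i, .p (i + 1) 1) := by
  have : (5 * i + 1) / 5 = i := by omega
  simp [edgeEnds, this]

lemma edgeEnds_two (i : ℕ) : edgeEnds (5 * i + 2) = (.p (i + 1) 1, .u (i + 1)) := by
  have : (5 * i + 2) / 5 = i := by omega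
  simp [edgeEnds, this]

lemma edgeEnds_three (i : ℕ) : edgeEnds (5 * i + 3) = (.v i, .q (i + 1) 1) := by
  have : (5 * i + 3) / 5 = i := by omega
  simp [edgeEnds, this]

lemma edgeEnds_four (i : ℕ) : edgeEnds (5 * i + 4) = (.q (i + 1) 1, .v (i + 1)) := by
  have : (5 * i + 4) / 5 = i := by omega
  simp [edgeEnds, this]

lemma exists_eq_five_mul (x : ℕ) :
    ∃ i, x = 5 * i ∨ x = 5 * i + 1 ∨ x = 5 * i + 2 ∨ x = 5 * i + 3 ∨ x = 5 * i + 4 :=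
  ⟨x / 5, by omega⟩

lemma edgeEnds_mem {t x : ℕ} (hx : x ≤ 5 * t) :
    (edgeEnds x).1 ∈ PVset 3 t ∧ (edgeEnds x).2 ∈ PVset 3 t := by
  unfold edgeEnds PVset
  split_ifs <;> simp <;> omega

lemma edgeEnds_adj (x : ℕ) : (pFull 3).Adj (edgeEnds x).1 (edgeEnds x).2 := by
  unfold edgeEnds pFull
  split_ifs <;> simp [SimpleGraph.fromRel_adj, pRel]

lemma edgeEnds_share {x y : ℕ} (hxy : x ≠ y) :
    ((edgeEnds x).1 = (edgeEnds y).1 ∨ (edgeEnds x).1 = (edgeEnds y).2 ∨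
      (edgeEnds x).2 = (edgeEnds y).1 ∨ (edgeEnds x).2 = (edgeEnds y).2) ↔ edgeRel x y := by
  obtain ⟨i, hi⟩ := exists_eq_five_mul x
  obtain ⟨j, hj⟩ := exists_eq_five_mul y
  rcases hi with rfl | rfl | rfl | rfl | rfl
  · rw [edgeRel_of_mod_zero (by omega)]
    rcases hj with rfl | rfl | rfl | rfl | rfl <;> simp [edgeEnds_zero, edgeEnds_one,
      edgeEnds_two, edgeEnds_three, edgeEnds_four] <;> omega
  · rw [edgeRel_of_mod_one (by omega)]
    rcases hj with rfl | rfl | rfl | rfl | rfl <;> simp [edgeEnds_zero, edgeEnds_one,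
      edgeEnds_two, edgeEnds_three, edgeEnds_four] <;> omega
  · rw [edgeRel_of_mod_two (by omega)]
    rcases hj with rfl | rfl | rfl | rfl | rfl <;> simp [edgeEnds_zero, edgeEnds_one,
      edgeEnds_two, edgeEnds_three, edgeEnds_four] <;> omega
  · rw [edgeRel_of_mod_three (by omega)]
    rcases hj with rfl | rfl | rfl | rfl | rfl <;> simp [edgeEnds_zero, edgeEnds_one,
      edgeEnds_two, edgeEnds_three, edgeEnds_four] <;> omega
  · rw [edgeRel_of_mod_four (by omega)]
    rcases hj with rfl | rfl | rfl | rfl | rfl <;> simp [edgeEnds_zero, edgeEnds_one,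
      edgeEnds_two, edgeEnds_three, edgeEnds_four] <;> omega

lemma exists_edgeEnds {t : ℕ} {a b : PV} (ha : a ∈ PVset 3 t) (hb : b ∈ PVset 3 t)
    (h : pRel 3 a b) : ∃ x ≤ 5 * t, s((edgeEnds x).1, (edgeEnds x).2) = s(a, b) := by
  rcases a with i | i | ⟨i, j⟩ | ⟨i, j⟩ <;> rcases b with i' | i' | ⟨i', j'⟩ | ⟨i', j'⟩ <;>
    simp [pRel, PVset] at h ha hb
  · exact ⟨5 * i, by omega, by rw [edgeEnds_zero, h]⟩
  · rcases h with ⟨rfl, rfl⟩ | ⟨rfl, rfl⟩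
    · exact ⟨5 * i + 1, by omega, by rw [edgeEnds_one]⟩
    · obtain ⟨m, rfl⟩ : ∃ m, i' = m + 1 := ⟨i' - 1, by omega⟩
      exact ⟨5 * m + 2, by omega, by rw [edgeEnds_two, Sym2.eq_swap]⟩
  · rcases h with ⟨rfl, rfl⟩ | ⟨rfl, rfl⟩
    · exact ⟨5 * i + 3, by omega, by rw [edgeEnds_three]⟩
    · obtain ⟨m, rfl⟩ : ∃ m, i' = m + 1 := ⟨i' - 1, by omega⟩
      exact ⟨5 * m + 4, by omega, by rw [edgeEnds_four, Sym2.eq_swap]⟩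
  · omega
  · omega

lemma finite_PVset (t : ℕ) : (PVset 3 t).Finite := by
  refine (((finite_Iic t).image PV.u).union (((finite_Iic t).image PV.v).union
    (((finite_Iic t).image fun i => PV.p i 1).union
      ((finite_Iic t).image fun i => PV.q i 1)))).subset ?_
  rintro (i | i | ⟨i, j⟩ | ⟨i, j⟩) h <;> simp [PVset] at h ⊢ <;> omega

noncomputable instance (t : ℕ) : Fintype (PVset 3 t) := (finite_PVset t).fintype

/-- Two edges share an endpoint. -/
def shareEnd {V : Type} (e e' : Sym2 V) : Prop := ∃ x, x ∈ e ∧ x ∈ e'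

/-- The `x`-th edge of `polyP 3 t`. -/
noncomputable def tilingEdge (t x : ℕ) : Sym2 (PVset 3 t) :=
  if h : x ≤ 5 * t then
    s(⟨(edgeEnds x).1, (edgeEnds_mem h).1⟩, ⟨(edgeEnds x).2, (edgeEnds_mem h).2⟩)
  else s(⟨.u 0, Nat.zero_le t⟩, ⟨.u 0, Nat.zero_le t⟩)

lemma mem_tilingEdge {t x : ℕ} (h : x ≤ 5 * t) (z : PVset 3 t) :
    z ∈ tilingEdge t x ↔ z.1 = (edgeEnds x).1 ∨ z.1 = (edgeEnds x).2 := by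
  rw [tilingEdge, dif_pos h, Sym2.mem_iff, Subtype.ext_iff, Subtype.ext_iff]

lemma shareEnd_tilingEdge {t x y : ℕ} (hx : x ≤ 5 * t) (hy : y ≤ 5 * t) (hxy : x ≠ y) :
    shareEnd (tilingEdge t x) (tilingEdge t y) ↔ edgeRel x y := by
  rw [← edgeEnds_share hxy]
  simp only [shareEnd, mem_tilingEdge hx, mem_tilingEdge hy]
  constructor
  · rintro ⟨z, h1 | h1, h2 | h2⟩ <;> rw [h1] at h2 <;> simp [h2]
  · have h := edgeEnds_mem hx
    rintro (h1 | h1 | h1 | h1)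
    exacts [⟨⟨_, h.1⟩, .inl rfl, .inl h1⟩, ⟨⟨_, h.1⟩, .inl rfl, .inr h1⟩,
      ⟨⟨_, h.2⟩, .inr rfl, .inl h1⟩, ⟨⟨_, h.2⟩, .inr rfl, .inr h1⟩]

lemma edgeEnds_injective {x y : ℕ} (h1 : (edgeEnds x).1 = (edgeEnds y).1 ∨
    (edgeEnds x).1 = (edgeEnds y).2) (h2 : (edgeEnds x).2 = (edgeEnds y).1 ∨
    (edgeEnds x).2 = (edgeEnds y).2) : x = y := by
  obtain ⟨i, hi⟩ := exists_eq_five_mul x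
  obtain ⟨j, hj⟩ := exists_eq_five_mul y
  rcases hi with rfl | rfl | rfl | rfl | rfl <;> rcases hj with rfl | rfl | rfl | rfl | rfl <;>
    simp [edgeEnds_zero, edgeEnds_one, edgeEnds_two, edgeEnds_three, edgeEnds_four] at h1 h2 <;>
    omega

lemma mem_edgeSet_polyP {t : ℕ} (e : Sym2 (PVset 3 t)) :
    e ∈ (polyP 3 t).edgeSet ↔ ∃ x ≤ 5 * t, tilingEdge t x = e := by
  constructor
  · induction e using Sym2.ind with
    | _ a b =>
      intro h
      have h' : ∃ x ≤ 5 * t, s((edgeEnds x).1, (edgeEnds x).2) = s(a.1, b.1) := by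
        rcases h.2 with h | h
        · exact exists_edgeEnds a.2 b.2 h
        · rw [Sym2.eq_swap]
          exact exists_edgeEnds b.2 a.2 h
      obtain ⟨x, hx, he⟩ := h'
      refine ⟨x, hx, Sym2.map.injective Subtype.val_injective ?_⟩
      rw [tilingEdge, dif_pos hx]
      exact he
  · rintro ⟨x, hx, rfl⟩
    rw [tilingEdge, dif_pos hx]
    exact edgeEnds_adj x

lemma tilingEdge_injOn {t x y : ℕ} (hx : x ≤ 5 * t) (hy : y ≤ 5 * t)
    (h : tilingEdge t x = tilingEdge t y) : x = y := by
  have key := fun z => mem_tilingEdge hx z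
  simp only [h, mem_tilingEdge hy] at key
  exact edgeEnds_injective ((key ⟨_, (edgeEnds_mem hx).1⟩).2 (.inl rfl))
    ((key ⟨_, (edgeEnds_mem hx).2⟩).2 (.inr rfl))

lemma isLowerSet_matchCx {V : Type} (G : SimpleGraph V) : IsLowerSet (matchCx G) :=
  fun _ _ hts hs => ⟨fun _ he => hs.1 (hts he),
    fun e he e' he' => hs.2 e (hts he) e' (hts he')⟩

theorem mapConn_matchCx_polyP (t : ℕ) : MapConn (t + 1) (matchCx (polyP 3 t)) := by
  classical
  have hpeel := ((peel_edgeRel t t).1 0 (zero_add t) (Finset.range (5 * t + 1)) fun x => by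
    rw [Finset.mem_range]; omega).map (R' := shareEnd) (φ := tilingEdge t)
    (fun x hx y hy => tilingEdge_injOn (by grind) (by grind))
    fun x hx y hy => shareEnd_tilingEdge (by grind) (by grind)
  have hK : matchCx (polyP 3 t) =
      freeSets shareEnd ((Finset.range (5 * t + 1)).image (tilingEdge t)) := by
    ext s
    refine and_congr (forall_congr' fun e => imp_congr Iff.rfl ?_) ?_
    · rw [mem_edgeSet_polyP, Finset.mem_image]
      simp only [Finset.mem_range, Nat.lt_succ_iff]
    · simp only [shareEnd, not_exists, not_and]
  rw [hK]
  exact hpeel.mapConn fun a b ⟨x, ha, hb⟩ => ⟨x, hb, ha⟩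

/-- The larger of the positions of the rungs met by the `x`-th edge. -/
def edgeLabel (x : ℕ) : ℕ := if x % 5 = 2 ∨ x % 5 = 4 then x / 5 + 1 else x / 5

lemma edgeRel_edgeLabel {x : ℕ} (h : x ≠ 5 * edgeLabel x) : edgeRel (5 * edgeLabel x) x := by
  rw [edgeRel_of_mod_zero (by omega)]
  unfold edgeLabel at h ⊢
  split_ifs at h ⊢ <;> omega

theorem not_isConn_matchCx_polyP {t : ℕ} (ht : 1 ≤ t) :
    ¬ IsConn (geom (matchCx (polyP 3 t))) t := by
  classical
  have hmem : ∀ {s : Finset (Sym2 (PVset 3 t))}, s ∈ matchCx (polyP 3 t) ↔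
      (∀ e ∈ s, ∃ x ≤ 5 * t, tilingEdge t x = e) ∧
        ∀ x ≤ 5 * t, ∀ y ≤ 5 * t, tilingEdge t x ∈ s → tilingEdge t y ∈ s → x ≠ y →
          ¬ edgeRel x y := by
    intro s
    constructor
    · refine fun hs => ⟨fun e he => (mem_edgeSet_polyP e).1 (hs.1 he), ?_⟩
      intro x hx y hy hxs hys hxy hr
      obtain ⟨z, hzx, hzy⟩ := (shareEnd_tilingEdge hx hy hxy).2 hr
      exact hs.2 _ hxs _ hys (fun h => hxy (tilingEdge_injOn hx hy h)) z hzx hzy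
    · rintro ⟨h1, h2⟩
      refine ⟨fun e he => (mem_edgeSet_polyP e).2 (h1 e he), fun e he e' he' hne z hz hz' => ?_⟩
      obtain ⟨x, hx, rfl⟩ := h1 e he
      obtain ⟨y, hy, rfl⟩ := h1 e' he'
      have hxy : x ≠ y := fun h => hne (h ▸ rfl)
      exact h2 x hx y hy he he' hxy ((shareEnd_tilingEdge hx hy hxy).1 ⟨z, hz, hz'⟩)
  have hcode : ∃ c : Sym2 (PVset 3 t) → ℕ, ∀ x ≤ 5 * t, c (tilingEdge t x) = x := by
    refine ⟨Function.invFunOn (tilingEdge t) (Iic (5 * t)), fun x hx => ?_⟩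
    exact (show InjOn (tilingEdge t) (Iic (5 * t)) from fun x hx y hy =>
      tilingEdge_injOn hx hy).leftInvOn_invFunOn hx
  obtain ⟨c, hc⟩ := hcode
  let γ : ℕ → ℕ := fun i => if i < t then 5 * i + 1 else 5 * t - 1
  have hγ : ∀ i, γ i ≤ 5 * t := fun i => by simp only [γ]; split_ifs <;> omega
  let l : Sym2 (PVset 3 t) → Fin (t + 1) := fun e =>
    ⟨min (edgeLabel (c e)) t, Nat.lt_succ_of_le (min_le_right _ _)⟩
  have hl : ∀ x ≤ 5 * t, (l (tilingEdge t x) : ℕ) = edgeLabel x := fun x hx => by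
    simp only [l, hc x hx, edgeLabel]
    split_ifs <;> omega
  have hlγ : ∀ i ≤ t, edgeLabel (γ i) = i := fun i hi => by
    simp only [γ, edgeLabel]
    split_ifs <;> omega
  have hl0 : ∀ i, edgeLabel (5 * i) = i := fun i => by simp [edgeLabel]
  refine not_isConn_of_crossPolytope (fun i => tilingEdge t (5 * i)) (fun i => tilingEdge t (γ i))
    l (fun i => Fin.ext ?_) (fun i => Fin.ext ?_) (fun i h => ?_) (fun s h1 h2 => ?_)
    (fun s hs e he ha => ?_)
  · rw [hl _ (by omega), hl0]
  · rw [hl _ (hγ _), hlγ _ (by omega)]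
  · have := tilingEdge_injOn (hγ i) (by omega) h
    simp only [γ] at this
    split_ifs at this <;> omega
  · have h3 : ∀ e ∈ s, ∃ i ≤ t, e = tilingEdge t (5 * i) ∨ e = tilingEdge t (γ i) := fun e he =>
      ⟨l e, Nat.le_of_lt_succ (l e).2, h1 e he⟩
    refine hmem.2 ⟨fun e he => ?_, fun x hx y hy hxs hys hxy => ?_⟩
    · obtain ⟨i, hi, rfl | rfl⟩ := h3 e he
      exacts [⟨_, by omega, rfl⟩, ⟨_, hγ i, rfl⟩]
    · have h4 : ∀ x ≤ 5 * t, tilingEdge t x ∈ s → ∃ i ≤ t, x = 5 * i ∨ x = γ i := fun x hx h => by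
        obtain ⟨i, hi, h | h⟩ := h3 _ h
        exacts [⟨i, hi, .inl (tilingEdge_injOn hx (by omega) h)⟩,
          ⟨i, hi, .inr (tilingEdge_injOn hx (hγ i) h)⟩]
      have h5 : ∀ i ≤ t, tilingEdge t (5 * i) ∈ s → tilingEdge t (γ i) ∉ s := fun i hi =>
        h2 ⟨i, Nat.lt_succ_of_le hi⟩
      obtain ⟨i, hi, hxi⟩ := h4 x hx hxs
      obtain ⟨j, hj, hyj⟩ := h4 y hy hys
      have hij : i ≠ j := by
        rintro rfl
        rcases hxi with rfl | rfl <;> rcases hyj with rfl | rfl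
        exacts [hxy rfl, h5 i hi hxs hys, h5 i hi hys hxs, hxy rfl]
      unfold edgeRel edgeRelAux
      simp only [γ] at hxi hyj
      split_ifs at hxi hyj <;> omega
  · obtain ⟨hs1, hs2⟩ := hmem.1 hs
    obtain ⟨x, hx, rfl⟩ := hs1 e he
    have h5 : 5 * (l (tilingEdge t x) : ℕ) ≤ 5 * t := by omega
    have h6 := hl x hx
    by_contra hne
    refine hs2 _ h5 x hx ha he (fun h => hne (congrArg (tilingEdge t) h.symm)) ?_
    rw [h6]
    exact edgeRel_edgeLabel fun h => hne (by rw [h6, ← h])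

end

/-- The connectivity of the matching complex of the
`(1 × 1 × t)`-honeycomb graph `P_{3,t}` is exactly `t - 1`: it is `(t-1)`-connected but
not `t`-connected. -/
theorem stmt_10 (t : ℕ) (ht : 1 ≤ t) :
    IsConn (geom (matchCx (polyP 3 t))) ((t:ℤ) - 1) ∧
    ¬ IsConn (geom (matchCx (polyP 3 t))) (t:ℤ) :=
  ⟨(mapConn_matchCx_polyP t).isConn (isLowerSet_matchCx _), not_isConn_matchCx_polyP ht⟩
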